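/- Let (A,𝔪) be a commutative Noetherian local ring which is a local complete intersection: the 𝔪-adic completion Â of A admits a surjective ring homomorphism π : Q → Â from a regular local ring (Q,𝔫) whose kernel is generated by a Q-regular sequence f_1,…,f_c ∈ 𝔫². Let M and D be finitely generated A-modules and let I be an ideal of A. Then: (1) the union ⋃_{n≥0} ⋃_{i≥0} Ass_A Ext^i_A(M, I^n D) is a finite set; (2) there exist i_0, n_0 such that for all i ≥ i_0 and n ≥ n_0 one has Ass_A Ext^{2i}_A(M, I^n D) = Ass_A Ext^{2i_0}_A(M, I^{n_0} D) and Ass_A Ext^{2i+1}_A(M, I^n D) = Ass_A Ext^{2i_0+1}_A(M, I^{n_0} D). -/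

import Mathlib

open CategoryTheory

/-- The `i`-th Ext module `Ext^i_A(M, N)` of `A`-modules, as a type. -/
noncomputable abbrev extAP (A : Type) [CommRing A] (M N : Type) [AddCommGroup M] [Module A M]
    [AddCommGroup N] [Module A N] (i : ℕ) : Type :=
  ((Ext A (ModuleCat A) i).obj (Opposite.op (ModuleCat.of A M))).obj (ModuleCat.of A N)


/-- Projective dimension at most `n`, for finite modules, via arbitrary syzygies. -/
def PdLE (R : Type) [CommRing R] : ℕ → (M : Type) → [AddCommGroup M] → [Module R M] → Prop
  | 0, M, _, _ => Module.Projective R M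
  | n + 1, M, _, _ => ∀ (P : Type) [AddCommGroup P] [Module R P] [Module.Finite R P]
      [Module.Projective R P] (φ : P →ₗ[R] M), Function.Surjective φ →
      PdLE R n (LinearMap.ker φ)

theorem PdLE.congr {R : Type} [CommRing R] : ∀ {n : ℕ} {M N : Type} [AddCommGroup M] [Module R M]
    [AddCommGroup N] [Module R N] (_ : M ≃ₗ[R] N), PdLE R n M → PdLE R n N
  | 0, M, N, _, _, _, _, e, h => by
    simp only [PdLE] at h ⊢
    exact Module.Projective.of_equiv e
  | n + 1, M, N, _, _, _, _, e, h => by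
    simp only [PdLE] at h ⊢
    intro P _ _ _ _ φ hφ
    have := h P (e.symm.toLinearMap ∘ₗ φ) (e.symm.surjective.comp hφ)
    rwa [LinearMap.ker_comp_of_ker_eq_bot _ (LinearEquiv.ker _)] at this

/-- the kernel of a surjection with regular target, modulo x. -/
noncomputable def kerQuotEquiv {R : Type} [CommRing R] (x : R) {P M : Type} [AddCommGroup P]
    [Module R P] [AddCommGroup M] [Module R M] (φ : P →ₗ[R] M) (hφ : Function.Surjective φ)
    (hM : IsSMulRegular M x) :
    QuotSMulTop x (LinearMap.ker φ) ≃ₗ[R ⧸ Ideal.span {x}]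
      LinearMap.ker (LinearMap.extendScalarsOfSurjective
        (Ideal.Quotient.mk_surjective (I := Ideal.span {x})) (QuotSMulTop.map x φ)) := by
  let g : QuotSMulTop x (LinearMap.ker φ) →ₗ[R ⧸ Ideal.span {x}] QuotSMulTop x P :=
    LinearMap.extendScalarsOfSurjective
        (Ideal.Quotient.mk_surjective (I := Ideal.span {x}))
        (QuotSMulTop.map x (LinearMap.ker φ).subtype)
  have hg : ∀ z : LinearMap.ker φ, g (Submodule.Quotient.mk z) = Submodule.Quotient.mk (z : P) :=
    fun z => rfl
  have hφ' : ∀ p : P, QuotSMulTop.map x φ (Submodule.Quotient.mk p)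
    = Submodule.Quotient.mk (φ p) := fun z => rfl
  have mem : ∀ y, g y ∈ LinearMap.ker (LinearMap.extendScalarsOfSurjective
        (Ideal.Quotient.mk_surjective (I := Ideal.span {x})) (QuotSMulTop.map x φ)) := by
    intro y
    obtain ⟨z, rfl⟩ := Submodule.Quotient.mk_surjective _ y
    rw [LinearMap.mem_ker, hg]
    change QuotSMulTop.map x φ (Submodule.Quotient.mk (z : P)) = 0
    rw [hφ', z.2]; rfl
  refine LinearEquiv.ofBijective (g.codRestrict _ mem) ⟨?_, ?_⟩
  · rw [injective_iff_map_eq_zero]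
    intro y hy
    obtain ⟨z, rfl⟩ := Submodule.Quotient.mk_surjective _ y
    have h1 : g (Submodule.Quotient.mk z) = 0 := congrArg Subtype.val hy
    rw [hg, Submodule.Quotient.mk_eq_zero, Submodule.mem_smul_pointwise_iff_exists] at h1
    obtain ⟨p, -, hp⟩ := h1
    rw [Submodule.Quotient.mk_eq_zero, Submodule.mem_smul_pointwise_iff_exists]
    have : φ p = 0 := by
      have h2 : x • φ p = x • 0 := by
        rw [← map_smul, hp, smul_zero]; exact z.2
      exact hM h2
    exact ⟨⟨p, this⟩, trivial, Subtype.ext hp⟩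
  · rintro ⟨y, hy⟩
    obtain ⟨p, rfl⟩ := Submodule.Quotient.mk_surjective _ y
    rw [LinearMap.mem_ker] at hy
    change QuotSMulTop.map x φ (Submodule.Quotient.mk p) = 0 at hy
    rw [hφ', Submodule.Quotient.mk_eq_zero, Submodule.mem_smul_pointwise_iff_exists] at hy
    obtain ⟨m, -, hm⟩ := hy
    obtain ⟨q, rfl⟩ := hφ m
    refine ⟨Submodule.Quotient.mk ⟨p - x • q, ?_⟩, Subtype.ext ?_⟩
    · rw [LinearMap.mem_ker, map_sub, map_smul, hm, sub_self]
    · change g _ = _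
      rw [hg, Submodule.Quotient.eq]
      rw [Submodule.mem_smul_pointwise_iff_exists]
      exact ⟨-q, trivial, by simp⟩

theorem PdLE.of_quot {R : Type} [CommRing R] [IsLocalRing R] [IsNoetherianRing R] (x : R)
    (hx : x ∈ IsLocalRing.maximalIdeal R) (hxR : IsSMulRegular R x) : ∀ {n : ℕ} {M : Type}
    [AddCommGroup M] [Module R M] [Module.Finite R M] (_ : IsSMulRegular M x),
    PdLE (R ⧸ Ideal.span {x}) n (QuotSMulTop x M) → PdLE R n M
  | 0, M, _, _, _, hM, h => by
    simp only [PdLE] at h ⊢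
    haveI : Nontrivial (R ⧸ Ideal.span {x}) := by
      rw [Ideal.Quotient.nontrivial_iff]
      intro h
      rw [Ideal.span_singleton_eq_top] at h
      exact hx h
    haveI : IsLocalRing (R ⧸ Ideal.span {x}) :=
      IsLocalRing.of_surjective' (Ideal.Quotient.mk _) Ideal.Quotient.mk_surjective
    haveI : Module.Finite (R ⧸ Ideal.span {x}) (QuotSMulTop x M) :=
      Module.Finite.of_restrictScalars_finite R _ _
    haveI : Module.Free (R ⧸ Ideal.span {x}) (QuotSMulTop x M) :=
      Module.free_of_flat_of_isLocalRing
    haveI := Module.finitePresentation_of_finite R M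
    have := (Module.free_quotSMulTop_iff_free (R := R) (M := M)
      (by rwa [IsLocalRing.jacobson_eq_maximalIdeal _ bot_ne_top]) hM).1 inferInstance
    infer_instance
  | n + 1, M, _, _, _, hM, h => by
    simp only [PdLE] at h ⊢
    intro P _ _ _ _ φ hφ
    have hP : IsSMulRegular P x := by
      obtain ⟨s, hs⟩ := Module.projective_def'.1 (inferInstance : Module.Projective R P)
      have hinj : Function.Injective s := fun a b hab => by
        have := congrArg (Finsupp.linearCombination R (id : P → P)) hab
        simpa [← LinearMap.comp_apply, hs] using this
      intro a b hab
      apply hinj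
      have : x • s a = x • s b := by rw [← map_smul, ← map_smul]; exact congrArg s hab
      ext i
      exact hxR (by simpa using DFunLike.congr_fun this i)
    have hZ : IsSMulRegular (LinearMap.ker φ) x := fun a b hab =>
      Subtype.ext (hP (congrArg Subtype.val hab))
    apply PdLE.of_quot x hx hxR hZ
    haveI : Module.Finite (R ⧸ Ideal.span {x}) (QuotSMulTop x P) :=
      Module.Finite.of_restrictScalars_finite R _ _
    haveI : Module.Projective (R ⧸ Ideal.span {x}) (QuotSMulTop x P) :=
      Module.Projective.of_equiv ((QuotSMulTop.equivQuotTensor x P).symm.extendScalarsOfSurjective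
        (Ideal.Quotient.mk_surjective (I := Ideal.span {x})))
    refine PdLE.congr (kerQuotEquiv x φ hφ hM).symm (h _ _ ?_)
    intro y
    obtain ⟨m, rfl⟩ := Submodule.Quotient.mk_surjective _ y
    obtain ⟨p, rfl⟩ := hφ m
    exact ⟨Submodule.Quotient.mk p, rfl⟩


theorem regular_aux : ∀ (d : ℕ) (R : Type) [CommRing R] [IsLocalRing R] [IsNoetherianRing R]
    (s : Finset R), Ideal.span (s : Set R) = IsLocalRing.maximalIdeal R → s.card ≤ d →
    (d : WithBot ℕ∞) ≤ ringKrullDim R →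
    IsDomain R ∧ ∀ (M : Type) [AddCommGroup M] [Module R M] [Module.Finite R M], PdLE R d M
  | 0, R, _, _, _, s, hs, hc, hd => by
    have : s = ∅ := Finset.card_eq_zero.1 (Nat.le_zero.1 hc)
    subst this
    have hm : IsLocalRing.maximalIdeal R = ⊥ := by rw [← hs]; simp
    have hf := IsLocalRing.isField_iff_maximalIdeal_eq.2 hm
    refine ⟨hf.isDomain, fun M _ _ _ => ?_⟩
    simp only [PdLE]
    letI := hf.toField
    infer_instance
  | d + 1, R, _, _, _, s, hs, hc, hd => by
    classical
    set m := IsLocalRing.maximalIdeal R with hm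
    have hmin : ∀ p ∈ minimalPrimes R, ¬ m ≤ p := by
      intro p hp hle
      have hpr : p.IsPrime := hp.1.1
      have : p = m := le_antisymm (IsLocalRing.le_maximalIdeal hpr.ne_top) hle
      have h0 : m.height = 0 := by
        rw [← this]; exact Ideal.height_eq_zero_iff.2 hp
      have h1 := IsLocalRing.maximalIdeal_height_eq_ringKrullDim (R := R)
      rw [← hm, h0] at h1
      rw [← h1] at hd
      norm_cast at hd
    have hm2 : ¬ m ≤ m ^ 2 := by
      intro h
      have : m = ⊥ := by
        apply Submodule.eq_bot_of_le_smul_of_le_jacobson_bot m m (IsNoetherian.noetherian m)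
        · rwa [smul_eq_mul, ← pow_two]
        · rw [IsLocalRing.jacobson_eq_maximalIdeal _ bot_ne_top]
      obtain ⟨p, hp⟩ : (minimalPrimes R).Nonempty := by
        obtain ⟨p, hp, -⟩ := Ideal.exists_minimalPrimes_le (I := ⊥) (J := m) bot_le
        exact ⟨p, hp⟩
      exact hmin p hp (this ▸ bot_le)
    have hfin := minimalPrimes.finite_of_isNoetherianRing R
    have hav := (Ideal.subset_union_prime (s := insert (m ^ 2) hfin.toFinset)
      (f := (id : Ideal R → Ideal R)) (m ^ 2) (m ^ 2) (by
        intro i hi h1 _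
        rcases Finset.mem_insert.1 hi with h | h
        · exact absurd h h1
        · exact (hfin.mem_toFinset.1 h).1.1) (I := m)).not.2 (by
        rintro ⟨i, hi, hle⟩
        rcases Finset.mem_insert.1 hi with h | h
        · subst h; exact hm2 hle
        · exact hmin i (hfin.mem_toFinset.1 h) hle)
    rw [Set.not_subset] at hav
    obtain ⟨x, hxm, hx⟩ := hav
    have hx2 : x ∉ m ^ 2 := fun h => hx (Set.mem_biUnion (x := m ^ 2) (by simp) h)
    have hxp : ∀ p ∈ minimalPrimes R, x ∉ p := fun p hp h =>
      hx (Set.mem_biUnion (x := p) (by simp [hp]) h)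
    have hxs : x ∈ Ideal.span (s : Set R) := by rw [hs]; exact hxm
    obtain ⟨a, -, ha⟩ := Submodule.mem_span_finset.1 hxs
    obtain ⟨i, his, hai⟩ : ∃ i ∈ s, IsUnit (a i) := by
      by_contra hcon
      push Not at hcon
      apply hx2
      rw [← ha, pow_two]
      refine Ideal.sum_mem _ fun i hi => Ideal.mul_mem_mul (hcon i hi) ?_
      rw [← hs]; exact Ideal.subset_span hi
    have hi' : i ∈ Ideal.span {x} ⊔ Ideal.span ((s.erase i : Finset R) : Set R) := by
      obtain ⟨u, hu⟩ := hai
      have h1 : x = a i * i + ∑ j ∈ s.erase i, a j • j := by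
        rw [← ha, ← Finset.add_sum_erase s _ his]; rfl
      have h2 : i = (↑u⁻¹ : R) * (x - ∑ j ∈ s.erase i, a j • j) := by
        rw [h1, add_sub_cancel_right, ← hu, ← mul_assoc, Units.inv_mul, one_mul]
      have h3 : (↑u⁻¹ : R) * (x - ∑ j ∈ s.erase i, a j • j) ∈
          Ideal.span {x} ⊔ Ideal.span ((s.erase i : Finset R) : Set R) := by
        refine Ideal.mul_mem_left _ _ (Ideal.sub_mem _ ?_ ?_)
        · exact Ideal.mem_sup_left (Ideal.mem_span_singleton_self x)
        · refine Ideal.sum_mem _ fun j hj => Ideal.mem_sup_right ?_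
          exact Ideal.mul_mem_left _ _ (Ideal.subset_span hj)
      rwa [← h2] at h3
    have hnt : Nontrivial (R ⧸ Ideal.span {x}) := by
      rw [Ideal.Quotient.nontrivial_iff]
      intro h
      rw [Ideal.span_singleton_eq_top] at h
      exact hxm h
    have hloc : IsLocalRing (R ⧸ Ideal.span {x}) :=
      IsLocalRing.of_surjective' (Ideal.Quotient.mk _) Ideal.Quotient.mk_surjective
    obtain ⟨hdom, hpd⟩ := regular_aux d (R ⧸ Ideal.span {x})
      ((s.erase i).image (Ideal.Quotient.mk (Ideal.span {x}))) (by
        have h1 : (IsLocalRing.maximalIdeal (R ⧸ Ideal.span {x})) =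
          Ideal.map (Ideal.Quotient.mk (Ideal.span {x})) m := by
          refine le_antisymm ?_ ?_
          · intro y hy
            obtain ⟨r, rfl⟩ := Ideal.Quotient.mk_surjective y
            refine Ideal.mem_map_of_mem _ ?_
            intro hr
            exact hy (hr.map _)
          · apply IsLocalRing.le_maximalIdeal
            intro htop
            have htop' := congrArg (Ideal.comap (Ideal.Quotient.mk (Ideal.span {x}))) htop
            rw [Ideal.comap_map_of_surjective _ Ideal.Quotient.mk_surjective, Ideal.comap_top,
              ← RingHom.ker_eq_comap_bot, Ideal.mk_ker, sup_eq_left.2] at htop'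
            · exact (IsLocalRing.maximalIdeal.isMaximal R).ne_top htop'
            · rw [Ideal.span_singleton_le_iff_mem]; exact hxm
        rw [h1, Finset.coe_image, ← Ideal.map_span]
        refine le_antisymm (Ideal.map_mono ?_) ?_
        · rw [← hs]; exact Ideal.span_mono (by simp)
        · have hle : m ≤ Ideal.span {x} ⊔ Ideal.span ((s.erase i : Finset R) : Set R) := by
            rw [← hs, Ideal.span_le]
            intro j hj
            by_cases hji : j = i
            · rw [hji]; exact hi'
            · exact Ideal.mem_sup_right (Ideal.subset_span (by simp [hji]; exact hj))
          refine (Ideal.map_mono hle).trans ?_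
          rw [Ideal.map_sup]
          simp [Ideal.map_span])
      (by
        refine Finset.card_image_le.trans ?_
        rw [Finset.card_erase_of_mem his]; omega)
      (by
        have h := ringKrullDim_le_ringKrullDim_quotient_add_card ({x} : Finset R)
          (by rw [IsLocalRing.ringJacobson_eq_maximalIdeal]; intro y hy; rw [Finset.coe_singleton, Set.mem_singleton_iff] at hy; rw [hy]; exact hxm)
        have h2 := hd.trans h
        simp only [Finset.coe_singleton, Finset.card_singleton] at h2
        push_cast at h2
        rw [← Finset.coe_singleton] at *
        exact (WithBot.add_le_add_iff_right' (c := ((1 : ℕ∞) : WithBot ℕ∞)) (WithBot.coe_ne_bot)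
          (fun h => by
            have := WithBot.coe_injective h
            exact ENat.one_ne_top this)).1 h2)
    have hpx : (Ideal.span {x} : Ideal R).IsPrime :=
      (Ideal.Quotient.isDomain_iff_prime _).1 hdom
    obtain ⟨p, hp, hple⟩ := Ideal.exists_minimalPrimes_le (I := ⊥) (J := Ideal.span {x}) bot_le
    have hppr : p.IsPrime := hp.1.1
    have hp0 : p = ⊥ := by
      apply Submodule.eq_bot_of_le_smul_of_le_jacobson_bot m p (IsNoetherian.noetherian p)
      · intro y hy
        obtain ⟨r, rfl⟩ := Ideal.mem_span_singleton'.1 (hple hy)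
        rw [mul_comm]
        refine Ideal.mul_mem_mul hxm ?_
        exact (hppr.mem_or_mem hy).resolve_right (hxp p hp)
      · rw [IsLocalRing.jacobson_eq_maximalIdeal _ bot_ne_top]
    have hR : IsDomain R := by
      rw [hp0] at hppr
      haveI : NoZeroDivisors R := ⟨fun {a b} h => by
        have := hppr.mem_or_mem (x := a) (y := b) (by rw [h]; exact zero_mem _)
        simpa using this⟩
      exact NoZeroDivisors.to_isDomain R
    refine ⟨hR, fun M _ _ _ => ?_⟩
    simp only [PdLE]
    intro P _ _ _ _ φ hφ
    have hx0 : x ≠ 0 := fun h => hx2 (h ▸ zero_mem _)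
    have hxR : IsSMulRegular R x := fun a b h => mul_left_cancel₀ hx0 h
    have hP : IsSMulRegular P x := by
      haveI : Module.IsTorsionFree R P := inferInstance
      exact fun a b h => smul_right_injective P hx0 h
    apply PdLE.of_quot x hxm hxR (fun a b h => Subtype.ext (hP (congrArg Subtype.val h)))
    haveI : Module.Finite (R ⧸ Ideal.span {x}) (QuotSMulTop x (LinearMap.ker φ)) :=
      Module.Finite.of_restrictScalars_finite R _ _
    exact hpd _


/-- A graded module with a differential and strictly anticommuting homotopies. -/
structure DGS (R : Type) [CommRing R] (P : Type) [AddCommGroup P] [Module R P] {l : ℕ}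
    (f : Fin l → R) where
  d : P →ₗ[R] P
  σ : Fin l → P →ₗ[R] P
  pr : ℤ → P →ₗ[R] P
  dd : ∀ x, d (d x) = 0
  dσ : ∀ j x, d (σ j x) + σ j (d x) = f j • x
  σσ : ∀ i j x, σ i (σ j x) + σ j (σ i x) = 0
  σsq : ∀ j x, σ j (σ j x) = 0
  pr_pr : ∀ m n x, pr m (pr n x) = if m = n then pr n x else 0
  pr_d : ∀ n x, pr n (d x) = d (pr (n + 1) x)
  pr_σ : ∀ j n x, pr (n + 1) (σ j x) = σ j (pr n x)

namespace DGS

variable {R : Type} [CommRing R] {P : Type} [AddCommGroup P] [Module R P]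

theorem pr_same {l : ℕ} {f : Fin l → R} (S : DGS R P f) (n : ℤ) (x : P) :
    S.pr n (S.pr n x) = S.pr n x := by rw [S.pr_pr, if_pos rfl]

theorem pr_ne {l : ℕ} {f : Fin l → R} (S : DGS R P f) {m n : ℤ} (h : m ≠ n) (x : P) :
    S.pr m (S.pr n x) = 0 := by rw [S.pr_pr, if_neg h]

theorem pr_σ' {l : ℕ} {f : Fin l → R} (S : DGS R P f) (j : Fin l) (n : ℤ) (x : P) :
    S.pr n (S.σ j x) = S.σ j (S.pr (n - 1) x) := by
  have := S.pr_σ j (n - 1) x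
  rwa [sub_add_cancel] at this

/-- drop the first homotopy -/
def tail {l : ℕ} {f : Fin (l + 1) → R} (S : DGS R P f) : DGS R P (f ∘ Fin.succ) where
  d := S.d
  σ j := S.σ j.succ
  pr := S.pr
  dd := S.dd
  dσ j x := S.dσ _ x
  σσ i j x := S.σσ _ _ x
  σsq j x := S.σsq _ x
  pr_pr := S.pr_pr
  pr_d := S.pr_d
  pr_σ j := S.pr_σ _

/-- adjoin an exterior variable -/
def double {l : ℕ} {f : Fin (l + 1) → R} (S : DGS R P (f ∘ Fin.succ)) : DGS R (P × P) f where
  d := LinearMap.prod (S.d ∘ₗ LinearMap.fst R P P + f 0 • LinearMap.snd R P P)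
    (-(S.d ∘ₗ LinearMap.snd R P P))
  σ := Fin.cons (LinearMap.prod 0 (LinearMap.fst R P P))
    (fun j => LinearMap.prodMap (S.σ j) (-(S.σ j)))
  pr n := LinearMap.prodMap (S.pr n) (S.pr (n - 1))
  dd x := by ext <;> simp [S.dd]
  dσ j x := by
    refine Fin.cases ?_ (fun j => ?_) j
    · ext <;> simp
    · have h1 := S.dσ j x.1
      have h2 := S.dσ j x.2
      simp only [Function.comp] at h1 h2
      ext
      · simp [← h1]; abel
      · simp [← h2]
  σσ i j x := by
    refine Fin.cases ?_ (fun i => ?_) i <;> refine Fin.cases ?_ (fun j => ?_) j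
    · ext <;> simp
    · ext <;> simp
    · ext <;> simp
    · ext <;> simp [S.σσ]
  σsq j x := by
    refine Fin.cases ?_ (fun j => ?_) j
    · ext <;> simp
    · ext <;> simp [S.σsq]
  pr_pr m n x := by
    ext
    · by_cases h : m = n <;> simp [S.pr_pr, h]
    · by_cases h : m = n <;> simp [S.pr_pr, h]
  pr_d n x := by
    ext
    · simp [S.pr_d]
    · simp [S.pr_d]
  pr_σ j n x := by
    refine Fin.cases ?_ (fun j => ?_) j
    · ext <;> simp
    · have := S.pr_σ j (n - 1) x.2
      rw [sub_add_cancel] at this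
      ext <;> simp [S.pr_σ, this]

/-- attach cells -/
def cone {X : Type} [AddCommGroup X] [Module R X] {l : ℕ} {f : Fin l → R} (S : DGS R P f)
    (T : DGS R X f) (g : X →ₗ[R] P) (hgd : ∀ x, S.d (g x) + g (T.d x) = 0)
    (hgσ : ∀ j x, S.σ j (g x) + g (T.σ j x) = 0)
    (hgp : ∀ n x, S.pr n (g x) = g (T.pr (n + 1) x)) : DGS R (P × X) f where
  d := LinearMap.prod (S.d ∘ₗ LinearMap.fst R P X + g ∘ₗ LinearMap.snd R P X)
    (T.d ∘ₗ LinearMap.snd R P X)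
  σ j := LinearMap.prodMap (S.σ j) (T.σ j)
  pr n := LinearMap.prodMap (S.pr n) (T.pr n)
  dd x := by ext <;> simp [S.dd, T.dd, hgd]
  dσ j x := by
    ext
    · have h1 := S.dσ j x.1
      have h2 := hgσ j x.2
      simp only [LinearMap.prodMap_apply, LinearMap.prod_apply, Function.prod_apply,
        LinearMap.add_apply, LinearMap.comp_apply, LinearMap.fst_apply, LinearMap.snd_apply,
        Prod.fst_add, Prod.smul_fst, map_add]
      rw [eq_neg_of_add_eq_zero_right h2, ← h1]; abel
    · simpa using T.dσ j x.2
  σσ i j x := by ext <;> simp [S.σσ, T.σσ]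
  σsq j x := by ext <;> simp [S.σsq, T.σsq]
  pr_pr m n x := by
    by_cases h : m = n <;> simp [S.pr_pr, T.pr_pr, h]
  pr_d n x := by ext <;> simp [S.pr_d, T.pr_d, hgp]
  pr_σ j n x := by ext <;> simp [S.pr_σ, T.pr_σ]

/-- a module concentrated in one degree -/
def single (R : Type) [CommRing R] (P : Type) [AddCommGroup P] [Module R P] (k : ℤ) {l : ℕ}
    (f : Fin l → R) (hf : ∀ j (x : P), f j • x = 0) : DGS R P f where
  d := 0
  σ _ := 0
  pr n := if n = k then LinearMap.id else 0
  dd x := by simp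
  dσ j x := by simp [hf]
  σσ i j x := by simp
  σsq j x := by simp
  pr_pr m n x := by by_cases h : m = n <;> by_cases h' : n = k <;> simp [h, h']; aesop
  pr_d n x := by simp
  pr_σ j n x := by simp

theorem exists_cells {l : ℕ} {f : Fin l → R} (S : DGS R P f) (k : ℤ) {V : Type} [AddCommGroup V]
    [Module R V] [Module.Finite R V] [Module.Projective R V] (g₀ : V →ₗ[R] P)
    (hd : ∀ v, S.d (g₀ v) = 0) (hp : ∀ v, S.pr k (g₀ v) = g₀ v) :
    ∃ (X : Type) (_ : AddCommGroup X) (_ : Module R X) (_ : Module.Finite R X)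
      (_ : Module.Projective R X) (T : DGS R X f) (g : X →ₗ[R] P),
      (∀ x, S.d (g x) + g (T.d x) = 0) ∧ (∀ j x, S.σ j (g x) + g (T.σ j x) = 0) ∧
      (∀ n x, S.pr n (g x) = g (T.pr (n + 1) x)) ∧ (∀ n ≤ k, ∀ x, T.pr n x = 0) ∧
      (∀ v, ∃ x, T.d x = 0 ∧ g x = g₀ v) := by
  induction l with
  | zero =>
    refine ⟨V, _, _, inferInstance, inferInstance, single R V (k + 1) f (fun j => j.elim0), g₀,
      ?_, fun j => j.elim0, ?_, ?_, ?_⟩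
    · intro x; simp [single, hd]
    · intro n x
      by_cases h : n = k
      · subst h; simp [single, hp]
      · simp only [single]
        rw [if_neg (by omega), ← hp, S.pr_ne h]; simp
    · intro n hn x
      simp only [single]
      rw [if_neg (by omega)]; simp
    · intro v; exact ⟨v, by simp [single], rfl⟩
  | succ l ih =>
    obtain ⟨X, _, _, _, _, T, g, h1, h2, h3, h4, h5⟩ := ih S.tail hd hp
    simp only [tail] at h1 h2 h3
    have h1' : ∀ x, g (T.d x) = - S.d (g x) := fun x => eq_neg_of_add_eq_zero_right (h1 x)
    have h2' : ∀ j x, g (T.σ j x) = - S.σ j.succ (g x) :=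
      fun j x => eq_neg_of_add_eq_zero_right (h2 j x)
    refine ⟨X × X, _, _, inferInstance, inferInstance, T.double,
      g ∘ₗ LinearMap.fst R X X - S.σ 0 ∘ₗ g ∘ₗ LinearMap.snd R X X, ?_, ?_, ?_, ?_, ?_⟩
    · intro x
      have h := S.dσ 0 (g x.2)
      have h' := eq_sub_of_add_eq h
      simp [double, h1', h']
      abel
    · intro j x
      refine Fin.cases ?_ (fun j => ?_) j
      · simp [double, S.σsq]
      · have h := eq_neg_of_add_eq_zero_right (S.σσ 0 j.succ (g x.2))
        simp [double, h2', h]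
    · intro n x
      simp [double, h3, S.pr_σ']
    · intro n hn x
      ext <;> simp [double, h4 n hn, h4 (n - 1) (by omega)]
    · intro v
      obtain ⟨x, hx, hx'⟩ := h5 v
      refine ⟨(x, 0), ?_, ?_⟩
      · ext <;> simp [double, hx]
      · simp [hx']

end DGS


namespace DGS

variable {R : Type} [CommRing R]

/-- quotient of a DGS -/
def quot {P : Type} [AddCommGroup P] [Module R P] {l : ℕ} {f : Fin l → R} (S : DGS R P f)
    (W : Submodule R P) (hd : W ≤ W.comap S.d) (hσ : ∀ j, W ≤ W.comap (S.σ j))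
    (hp : ∀ n, W ≤ W.comap (S.pr n)) : DGS R (P ⧸ W) f where
  d := W.mapQ W S.d hd
  σ j := W.mapQ W (S.σ j) (hσ j)
  pr n := W.mapQ W (S.pr n) (hp n)
  dd x := by
    obtain ⟨x, rfl⟩ := W.mkQ_surjective x
    simp [S.dd]
  dσ j x := by
    obtain ⟨x, rfl⟩ := W.mkQ_surjective x
    simp only [Submodule.mkQ_apply, Submodule.mapQ_apply, ← Submodule.Quotient.mk_add, S.dσ]
    rfl
  σσ i j x := by
    obtain ⟨x, rfl⟩ := W.mkQ_surjective x
    simp only [Submodule.mkQ_apply, Submodule.mapQ_apply, ← Submodule.Quotient.mk_add, S.σσ]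
    rfl
  σsq j x := by
    obtain ⟨x, rfl⟩ := W.mkQ_surjective x
    simp [S.σsq]
  pr_pr m n x := by
    obtain ⟨x, rfl⟩ := W.mkQ_surjective x
    by_cases h : m = n <;> simp [S.pr_pr, h]
  pr_d n x := by
    obtain ⟨x, rfl⟩ := W.mkQ_surjective x
    simp [S.pr_d]
  pr_σ j n x := by
    obtain ⟨x, rfl⟩ := W.mkQ_surjective x
    simp [S.pr_σ]

theorem proj_range {P : Type} [AddCommGroup P] [Module R P] [Module.Projective R P] {l : ℕ}
    {f : Fin l → R} (S : DGS R P f) (n : ℤ) : Module.Projective R (LinearMap.range (S.pr n)) := by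
  refine Module.Projective.of_split (LinearMap.range (S.pr n)).subtype (S.pr n).rangeRestrict ?_
  ext ⟨x, y, rfl⟩
  simp [S.pr_same]

theorem exists_stage [IsNoetherianRing R] {l : ℕ} (f : Fin l → R) (M : Type) [AddCommGroup M]
    [Module R M] [Module.Finite R M] (hf : ∀ j (m : M), f j • m = 0) (n : ℕ) :
    ∃ (G : Type) (_ : AddCommGroup G) (_ : Module R G) (_ : Module.Finite R G) (S : DGS R G f)
      (ι : M →ₗ[R] G) (η : G →ₗ[R] M), (∀ m, η (ι m) = m) ∧ (∀ x, ι (η x) = S.pr (-1) x) ∧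
      (∀ k : ℤ, 0 ≤ k → Module.Projective R (LinearMap.range (S.pr k))) ∧
      (∀ j x, S.σ j (S.pr (-1) x) = 0) ∧ (∀ k < -1, ∀ x, S.pr k x = 0) ∧
      (∀ k : ℤ, k < n - 1 → ∀ x, S.pr k x = x → S.d x = 0 → ∃ y, S.d y = x) := by
  induction n with
  | zero =>
    refine ⟨M, _, _, inferInstance, single R M (-1) f hf, LinearMap.id, LinearMap.id,
      by simp, by simp [single], ?_, by simp [single], ?_, ?_⟩
    · intro k hk
      have : (single R M (-1) f hf).pr k = 0 := by
        simp only [single]; rw [if_neg (by omega)]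
      rw [this, LinearMap.range_zero]
      infer_instance
    · intro k hk x
      simp only [single]; rw [if_neg (by omega)]; simp
    · intro k hk x hx _
      simp only [single] at hx; rw [if_neg (by push_cast at hk; omega)] at hx
      exact ⟨0, by rw [← hx]; simp⟩
  | succ n ih =>
    obtain ⟨G, _, _, _, S, ι, η, h1, h2, h3, h4, h5, h6⟩ := ih
    let Z : Submodule R G := LinearMap.ker (S.pr (n - 1) - LinearMap.id) ⊓ LinearMap.ker S.d
    have hZ : ∀ x, x ∈ Z ↔ S.pr (n - 1) x = x ∧ S.d x = 0 := by
      intro x; simp [Z, sub_eq_zero]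
    obtain ⟨r, q, hq⟩ := Module.Finite.exists_fin' R Z
    obtain ⟨X, _, _, _, _, T, g, c1, c2, c3, c4, c5⟩ := S.exists_cells (n - 1)
      (Z.subtype ∘ₗ q) (fun v => ((hZ _).1 (q v).2).2) (fun v => ((hZ _).1 (q v).2).1)
    refine ⟨G × X, _, _, inferInstance, S.cone T g c1 c2 c3, LinearMap.inl R G X ∘ₗ ι,
      η ∘ₗ LinearMap.fst R G X, by simp [h1], ?_, ?_, ?_, ?_, ?_⟩
    · intro x
      ext
      · simp [h2, cone]
      · simp [cone, c4 (-1) (by omega)]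
    · intro k hk
      have := h3 k hk
      have := T.proj_range k
      refine Module.Projective.of_split (M := LinearMap.range (S.pr k) × LinearMap.range (T.pr k))
        (LinearMap.prod ((S.pr k).rangeRestrict ∘ₗ LinearMap.fst R G X)
          ((T.pr k).rangeRestrict ∘ₗ LinearMap.snd R G X) ∘ₗ Submodule.subtype _)
        (((S.cone T g c1 c2 c3).pr k).rangeRestrict ∘ₗ LinearMap.prodMap (Submodule.subtype _)
          (Submodule.subtype _)) ?_
      refine LinearMap.ext ?_
      rintro ⟨x, y, rfl⟩
      refine Subtype.ext (Prod.ext ?_ ?_)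
      · change S.pr k (S.pr k (S.pr k y.1)) = S.pr k y.1
        rw [S.pr_same, S.pr_same]
      · change T.pr k (T.pr k (T.pr k y.2)) = T.pr k y.2
        rw [T.pr_same, T.pr_same]
    · intro j x
      ext
      · simp [cone, h4]
      · simp [cone, c4 (-1) (by omega)]
    · intro k hk x
      ext
      · simp [cone, h5 k hk]
      · simp [cone, c4 k (by omega)]
    · intro k hk x hx hdx
      have hx1 : S.pr k x.1 = x.1 := by simpa [cone] using congrArg Prod.fst hx
      have hx2 : x.2 = 0 := by
        have : T.pr k x.2 = x.2 := by simpa [cone] using congrArg Prod.snd hx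
        rw [← this]; exact c4 k (by push_cast at hk; omega) _
      have hdx1 : S.d x.1 = 0 := by simpa [cone, hx2] using congrArg Prod.fst hdx
      by_cases hk' : k < n - 1
      · obtain ⟨y, hy⟩ := h6 k hk' x.1 hx1 hdx1
        exact ⟨(y, 0), by ext <;> simp [cone, hy, hx2]⟩
      · have hkk : k = n - 1 := by push_cast at hk; omega
        subst hkk
        obtain ⟨v, hv⟩ := hq ⟨x.1, (hZ _).2 ⟨hx1, hdx1⟩⟩
        obtain ⟨y, hy, hy'⟩ := c5 v
        refine ⟨(0, y), ?_⟩
        ext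
        · simp [cone, hy', hv]
        · simp [cone, hy, hx2]

/-- cycles of degree k -/
def Zc {P : Type} [AddCommGroup P] [Module R P] {l : ℕ} {f : Fin l → R} (S : DGS R P f) (k : ℤ) :
    Submodule R P := LinearMap.ker (S.pr k - LinearMap.id) ⊓ LinearMap.ker S.d

theorem mem_Zc {P : Type} [AddCommGroup P] [Module R P] {l : ℕ} {f : Fin l → R} (S : DGS R P f)
    (k : ℤ) (x : P) : x ∈ S.Zc k ↔ S.pr k x = x ∧ S.d x = 0 := by
  simp [Zc, sub_eq_zero]

theorem exists_base [IsNoetherianRing R] {l : ℕ} (f : Fin l → R) (M : Type) [AddCommGroup M]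
    [Module R M] [Module.Finite R M] (hf : ∀ j (m : M), f j • m = 0) (N : ℕ)
    (hPd : PdLE R (N + 1) M) :
    ∃ (P : Type) (_ : AddCommGroup P) (_ : Module R P) (_ : Module.Finite R P)
      (_ : Module.Projective R P) (S : DGS R P f)
      (ε : P →ₗ[R] M), Function.Surjective ε ∧ (∀ x, ε (S.d x) = 0) ∧
      (∀ x, ε (S.pr 0 x) = ε x) ∧ (∀ n < 0, ∀ x, S.pr n x = 0) ∧
      (∀ n : ℤ, N + 1 < n → ∀ x, S.pr n x = 0) ∧
      (∀ x, S.d x = 0 → ε x = 0 → ∃ y, S.d y = x) := by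
  obtain ⟨G, _, _, _, S, ι, η, h1, h2, h3, h4, h5, h6⟩ := exists_stage f M hf (N + 3)
  have hex : ∀ k : ℤ, k ≤ N + 1 → ∀ x, S.pr k x = x → S.d x = 0 → ∃ y, S.d y = x ∧
      S.pr (k + 1) y = y := by
    intro k hk x hx hdx
    obtain ⟨y, hy⟩ := h6 k (by push_cast; omega) x hx hdx
    exact ⟨S.pr (k + 1) y, by rw [← S.pr_d, hy, hx], S.pr_same _ _⟩
  -- projective dimension of cycles
  have key : ∀ (j a : ℕ), j ≤ N + 1 → PdLE R (a + j) M → PdLE R a (S.Zc (j - 1)) := by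
    intro j
    induction j with
    | zero =>
      intro a _ h
      have e : M ≃ₗ[R] S.Zc ((0 : ℕ) - 1) := by
        refine LinearEquiv.ofBijective (ι.codRestrict _ ?_) ⟨?_, ?_⟩
        · intro m
          have hm : S.pr (-1) (ι m) = ι m := by rw [← h2, h1]
          rw [mem_Zc]
          refine ⟨by simpa using hm, ?_⟩
          have := S.pr_d (-2) (ι m)
          rw [h5 _ (by norm_num)] at this
          norm_num at this
          rw [hm] at this
          exact this.symm
        · intro x y hxy
          have : ι x = ι y := congrArg Subtype.val hxy
          rw [← h1 x, this, h1]
        · rintro ⟨x, hx⟩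
          rw [mem_Zc] at hx
          refine ⟨η x, Subtype.ext ?_⟩
          change ι (η x) = x
          rw [h2]; simpa using hx.1
      exact PdLE.congr e h
    | succ j ih =>
      intro a hj h
      have h' := ih (a + 1) (by omega) (by convert h using 1; omega)
      simp only [PdLE] at h'
      have := h3 j (by omega)
      let φ : LinearMap.range (S.pr j) →ₗ[R] S.Zc (j - 1) :=
        (S.d ∘ₗ Submodule.subtype _).codRestrict _ (by
          rintro ⟨x, y, rfl⟩
          rw [mem_Zc]
          refine ⟨?_, S.dd _⟩
          simp [S.pr_d, S.pr_same])
      have hφ : Function.Surjective φ := by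
        rintro ⟨x, hx⟩
        rw [mem_Zc] at hx
        obtain ⟨y, hy, hy'⟩ := hex _ (by omega) x hx.1 hx.2
        rw [sub_add_cancel] at hy'
        exact ⟨⟨y, y, hy'⟩, Subtype.ext hy⟩
      refine PdLE.congr ?_ (h' _ φ hφ)
      refine LinearEquiv.ofBijective (LinearMap.codRestrict _
        (Submodule.subtype _ ∘ₗ Submodule.subtype _) ?_) ⟨?_, ?_⟩
      · rintro ⟨⟨x, y, rfl⟩, hx⟩
        rw [mem_Zc]
        refine ⟨?_, congrArg Subtype.val hx⟩
        push_cast; rw [add_sub_cancel_right]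
        simp [S.pr_same]
      · intro x y hxy
        have h' := Subtype.ext_iff.1 hxy
        exact Subtype.ext (Subtype.ext h')
      · rintro ⟨x, hx⟩
        rw [mem_Zc] at hx
        push_cast at hx; rw [add_sub_cancel_right] at hx
        exact ⟨⟨⟨x, x, hx.1⟩, Subtype.ext hx.2⟩, rfl⟩
  have hproj : Module.Projective R (S.Zc N) := by
    have := key (N + 1) 0 le_rfl (by rwa [Nat.zero_add])
    simp only [PdLE] at this
    have e : (((N + 1 : ℕ) : ℤ) - 1) = N := by push_cast; ring
    exact e ▸ this
  -- section
  obtain ⟨s, hs⟩ : ∃ s : S.Zc N →ₗ[R] G, ∀ z, S.d (s z) = z ∧ S.pr (N + 1) (s z) = s z := by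
    let φ : LinearMap.range (S.pr (N + 1)) →ₗ[R] S.Zc N :=
      (S.d ∘ₗ Submodule.subtype _).codRestrict _ (by
        rintro ⟨x, y, rfl⟩
        rw [mem_Zc]
        refine ⟨?_, S.dd _⟩
        simp [S.pr_d, S.pr_same])
    have hφ : Function.Surjective φ := by
      rintro ⟨x, hx⟩
      rw [mem_Zc] at hx
      obtain ⟨y, hy, hy'⟩ := hex _ (by omega) x hx.1 hx.2
      exact ⟨⟨y, y, hy'⟩, Subtype.ext hy⟩
    obtain ⟨t, ht⟩ := Module.projective_lifting_property φ LinearMap.id hφ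
    refine ⟨Submodule.subtype _ ∘ₗ t, fun z => ⟨congrArg Subtype.val (LinearMap.congr_fun ht z), ?_⟩⟩
    obtain ⟨y, hy⟩ := (t z).2
    simp only [LinearMap.comp_apply, Submodule.subtype_apply]
    rw [← hy, S.pr_same]
  -- the subcomplex to kill
  let W : Submodule R G := (⨅ m : Fin (N + 1), LinearMap.ker (S.pr (m : ℕ))) ⊓
    LinearMap.ker (S.d ∘ₗ S.pr (N + 1))
  have hW : ∀ x, x ∈ W ↔ (∀ m : ℤ, 0 ≤ m → m ≤ N → S.pr m x = 0) ∧ S.d (S.pr (N + 1) x) = 0 := by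
    intro x
    simp only [W, Submodule.mem_inf, Submodule.mem_iInf, LinearMap.mem_ker, LinearMap.comp_apply]
    refine and_congr_left fun _ => ⟨fun h m h0 hm => ?_, fun h m => h _ (by omega) (by omega)⟩
    have := h ⟨m.toNat, by omega⟩
    simpa [Int.toNat_of_nonneg h0] using this
  have hWd : W ≤ W.comap S.d := by
    intro x hx
    rw [hW] at hx
    rw [Submodule.mem_comap, hW]
    refine ⟨fun m h0 hm => ?_, ?_⟩
    · rw [S.pr_d]
      by_cases h : m = N
      · rw [h]; exact hx.2
      · rw [hx.1 (m + 1) (by omega) (by omega), map_zero]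
    · rw [S.pr_d, S.dd]
  have hWσ : ∀ j, W ≤ W.comap (S.σ j) := by
    intro j x hx
    rw [hW] at hx
    rw [Submodule.mem_comap, hW]
    refine ⟨fun m h0 hm => ?_, ?_⟩
    · rw [S.pr_σ']
      by_cases h : m = 0
      · rw [h]; exact h4 j x
      · rw [hx.1 (m - 1) (by omega) (by omega), map_zero]
    · rw [S.pr_σ, hx.1 N (by omega) le_rfl, map_zero, map_zero]
  have hWp : ∀ n, W ≤ W.comap (S.pr n) := by
    intro n x hx
    rw [hW] at hx
    rw [Submodule.mem_comap, hW]
    refine ⟨fun m h0 hm => ?_, ?_⟩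
    · rw [S.pr_pr]; split_ifs with h
      · rw [← h]; exact hx.1 m h0 hm
      · rfl
    · rw [S.pr_pr]; split_ifs with h
      · rw [← h]; exact hx.2
      · exact map_zero _
  have hsum : ∀ x (m : ℤ), S.pr m (∑ k : Fin (N + 1), S.pr (k : ℕ) x) =
      if 0 ≤ m ∧ m ≤ N then S.pr m x else 0 := by
    intro x m
    rw [map_sum]
    split_ifs with h
    · rw [Finset.sum_eq_single ⟨m.toNat, by omega⟩]
      · simp [Int.toNat_of_nonneg h.1, S.pr_same]
      · intro b _ hb
        apply S.pr_ne
        intro h'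
        apply hb
        ext; simp; omega
      · simp
    · apply Finset.sum_eq_zero
      intro b _
      apply S.pr_ne
      omega
  have hprojP : Module.Projective R (G ⧸ W) := by
    have : ∀ k : Fin (N + 1), Module.Projective R (LinearMap.range (S.pr (k : ℕ))) :=
      fun k => h3 _ (by omega)
    have : Module.Projective R (∀ k : Fin (N + 1), LinearMap.range (S.pr (k : ℕ))) :=
      Module.Projective.of_equiv (DFinsupp.linearEquivFunOnFintype (R := R)
        (M := fun k : Fin (N + 1) => LinearMap.range (S.pr (k : ℕ))))
    let φ : G →ₗ[R] S.Zc N := (S.d ∘ₗ S.pr (N + 1)).codRestrict _ (by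
        intro x
        rw [mem_Zc]
        refine ⟨?_, S.dd _⟩
        simp [S.pr_d, S.pr_same])
    let i : G →ₗ[R] (∀ k : Fin (N + 1), LinearMap.range (S.pr (k : ℕ))) × S.Zc N :=
      LinearMap.prod (LinearMap.pi fun k => (S.pr (k : ℕ)).rangeRestrict) φ
    let b : (∀ k : Fin (N + 1), LinearMap.range (S.pr (k : ℕ))) × S.Zc N →ₗ[R] G :=
      LinearMap.coprod (LinearMap.lsum R _ R fun k => Submodule.subtype _) s
    have hbi : ∀ x, b (i x) = (∑ k : Fin (N + 1), S.pr (k : ℕ) x) + s (φ x) := by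
      intro x
      simp [b, i]
    refine Module.Projective.of_split (W.liftQ i ?_) (W.mkQ ∘ₗ b) ?_
    · intro x hx
      rw [hW] at hx
      rw [LinearMap.mem_ker]
      have e1 : φ x = 0 := Subtype.ext hx.2
      have e2 : (LinearMap.pi fun k : Fin (N + 1) => (S.pr (k : ℕ)).rangeRestrict) x = 0 := by
        ext k
        simpa using hx.1 k (by omega) (by omega)
      simp [i, e1, e2]
    · ext x
      simp only [LinearMap.comp_apply, Submodule.mkQ_apply, Submodule.liftQ_apply, hbi,
        LinearMap.id_apply]
      rw [Submodule.Quotient.eq, hW]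
      have hsz : ∀ m : ℤ, m ≠ N + 1 → S.pr m (s (φ x)) = 0 := by
        intro m hm
        rw [← (hs (φ x)).2, S.pr_ne hm]
      refine ⟨fun m h0 hm => ?_, ?_⟩
      · rw [map_sub, map_add, hsum, if_pos ⟨h0, hm⟩, hsz m (by omega), add_zero, sub_self]
      · rw [map_sub, map_add, hsum, if_neg (by omega), zero_add, (hs _).2, map_sub, (hs _).1]
        exact sub_self _
  refine ⟨G ⧸ W, _, _, inferInstance, hprojP, S.quot W hWd hWσ hWp,
    W.liftQ (η ∘ₗ S.d ∘ₗ S.pr 0) ?_, ?_, ?_, ?_, ?_, ?_, ?_⟩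
  · intro x hx
    rw [hW] at hx
    simp [hx.1 0 le_rfl (by omega)]
  · intro m
    have hm : S.pr (-1) (ι m) = ι m := by rw [← h2, h1]
    have hd : S.d (ι m) = 0 := by
      have := S.pr_d (-2) (ι m)
      rw [h5 _ (by norm_num)] at this
      norm_num at this
      rw [hm] at this
      exact this.symm
    obtain ⟨y, hy, hy'⟩ := hex _ (by omega) _ hm hd
    refine ⟨W.mkQ y, ?_⟩
    norm_num at hy'
    simp [hy, hy', h1]
  · intro x
    obtain ⟨x, rfl⟩ := W.mkQ_surjective x
    simp [quot, S.pr_d, S.dd]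
  · intro x
    obtain ⟨x, rfl⟩ := W.mkQ_surjective x
    simp [quot, S.pr_same]
  · intro n hn x
    obtain ⟨x, rfl⟩ := W.mkQ_surjective x
    simp only [quot, Submodule.mkQ_apply, Submodule.mapQ_apply, Submodule.Quotient.mk_eq_zero]
    rw [hW]
    refine ⟨fun m h0 hm => S.pr_ne (by omega) _, ?_⟩
    rw [S.pr_ne (by omega), map_zero]
  · intro n hn x
    obtain ⟨x, rfl⟩ := W.mkQ_surjective x
    simp only [quot, Submodule.mkQ_apply, Submodule.mapQ_apply, Submodule.Quotient.mk_eq_zero]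
    rw [hW]
    refine ⟨fun m h0 hm => S.pr_ne (by omega) _, ?_⟩
    rw [S.pr_ne (by omega), map_zero]
  · intro x hdx hεx
    obtain ⟨x, rfl⟩ := W.mkQ_surjective x
    simp only [quot, Submodule.mkQ_apply, Submodule.mapQ_apply, Submodule.Quotient.mk_eq_zero] at hdx
    rw [hW] at hdx
    simp only [Submodule.mkQ_apply, Submodule.liftQ_apply, LinearMap.comp_apply] at hεx
    have hd0 : S.d (S.pr 0 x) = 0 := by
      have e := h2 (S.d (S.pr 0 x))
      rw [hεx, map_zero, S.pr_d] at e
      norm_num at e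
      rw [S.pr_same] at e
      exact e.symm
    have hdk : ∀ m : ℤ, 0 ≤ m → m ≤ N + 1 → S.d (S.pr m x) = 0 := by
      intro m h0 hm
      by_cases h : m = 0
      · rw [h]; exact hd0
      · have := hdx.1 (m - 1) (by omega) (by omega)
        rwa [S.pr_d, sub_add_cancel] at this
    have hz : ∀ k : Fin (N + 1), ∃ z, S.d z = S.pr (k : ℕ) x := fun k => by
      obtain ⟨z, hz, -⟩ := hex k (by omega) _ (S.pr_same _ x) (hdk _ (by omega) (by omega))
      exact ⟨z, hz⟩
    choose z hz using hz
    refine ⟨W.mkQ (∑ k, z k), ?_⟩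
    simp only [quot, Submodule.mkQ_apply, Submodule.mapQ_apply]
    rw [Submodule.Quotient.eq, map_sum, hW]
    simp only [hz]
    refine ⟨fun m h0 hm => ?_, ?_⟩
    · rw [map_sub, hsum, if_pos ⟨h0, hm⟩, sub_self]
    · rw [map_sub, hsum, if_neg (by omega), zero_sub, map_neg, hdk _ (by omega) le_rfl, neg_zero]

end DGS


theorem smulReg_of_projective {R : Type} [CommRing R] {x : R} (hxR : IsSMulRegular R x) (P : Type)
    [AddCommGroup P] [Module R P] [Module.Projective R P] : IsSMulRegular P x := by
  obtain ⟨s, hs⟩ := Module.projective_def'.1 (inferInstance : Module.Projective R P)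
  have hinj : Function.Injective s := fun a b hab => by
    have := congrArg (Finsupp.linearCombination R (id : P → P)) hab
    simpa [← LinearMap.comp_apply, hs] using this
  intro a b hab
  apply hinj
  have : x • s a = x • s b := by rw [← map_smul, ← map_smul]; exact congrArg s hab
  ext i
  exact hxR (by simpa using DFunLike.congr_fun this i)

/-- A DGS with commuting operators of degree -2 which are jointly split injective in large
degree. -/
structure DGT (R : Type) [CommRing R] (P : Type) [AddCommGroup P] [Module R P] {l : ℕ}
    (f : Fin l → R) (J : Type) [Fintype J] extends DGS R P f where
  t : J → P →ₗ[R] P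
  s : J → P →ₗ[R] P
  n0 : ℤ
  t_d : ∀ i x, t i (d x) = d (t i x)
  t_σ : ∀ i j x, t i (σ j x) = σ j (t i x)
  t_t : ∀ i j x, t i (t j x) = t j (t i x)
  pr_t : ∀ i n x, pr n (t i x) = t i (pr (n + 2) x)
  s_t : ∀ n, n0 < n → ∀ x, ∑ i, s i (t i (pr n x)) = pr n x
  pr_neg : ∀ n < 0, ∀ x, pr n x = 0
  fg : ∀ n, ∃ u : Finset P, LinearMap.range (pr n) ≤ Submodule.span R (u : Set P)

/-- augmentation of a DGS making it a resolution -/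
structure IsAug {R : Type} [CommRing R] {P : Type} [AddCommGroup P] [Module R P] {l : ℕ}
    {f : Fin l → R} (S : DGS R P f) {B : Type} [CommRing B] (ρ : R →+* B) {M : Type}
    [AddCommGroup M] [Module B M] (ε : P →+ M) : Prop where
  smul : ∀ (r : R) x, ε (r • x) = ρ r • ε x
  surj : Function.Surjective ε
  aug_d : ∀ x, ε (S.d x) = 0
  aug_pr : ∀ x, ε (S.pr 0 x) = ε x
  exact : ∀ x, S.d x = 0 → ε x = 0 → ∃ y, S.d y = x

/-- coefficientwise map -/
noncomputable def mapK {R : Type} [CommRing R] {P : Type} [AddCommGroup P] [Module R P]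
    (φ : ℕ → P →ₗ[R] P) : (ℕ →₀ P) →ₗ[R] (ℕ →₀ P) where
  toFun x := Finsupp.onFinset x.support (fun k => φ k (x k)) (by
    intro k hk
    rw [Finsupp.mem_support_iff]
    intro h
    exact hk (by rw [h, map_zero]))
  map_add' x y := by ext k; simp
  map_smul' r x := by ext k; simp

@[simp] theorem mapK_apply {R : Type} [CommRing R] {P : Type} [AddCommGroup P] [Module R P]
    (φ : ℕ → P →ₗ[R] P) (x : ℕ →₀ P) (k : ℕ) : mapK φ x k = φ k (x k) := rfl

/-- shift down -/
noncomputable def shD (R : Type) [CommRing R] (P : Type) [AddCommGroup P] [Module R P] :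
    (ℕ →₀ P) →ₗ[R] (ℕ →₀ P) where
  toFun x := Finsupp.comapDomain Nat.succ x Nat.succ_injective.injOn
  map_add' x y := by ext k; simp
  map_smul' r x := by ext k; simp

@[simp] theorem shD_apply {R : Type} [CommRing R] {P : Type} [AddCommGroup P] [Module R P]
    (x : ℕ →₀ P) (k : ℕ) : shD R P x k = x (k + 1) := rfl

/-- shift up -/
noncomputable def shU (R : Type) [CommRing R] (P : Type) [AddCommGroup P] [Module R P] :
    (ℕ →₀ P) →ₗ[R] (ℕ →₀ P) := Finsupp.lmapDomain P R Nat.succ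

@[simp] theorem shU_succ {R : Type} [CommRing R] {P : Type} [AddCommGroup P] [Module R P]
    (x : ℕ →₀ P) (k : ℕ) : shU R P x (k + 1) = x k :=
  Finsupp.mapDomain_apply Nat.succ_injective x k

@[simp] theorem shU_zero {R : Type} [CommRing R] {P : Type} [AddCommGroup P] [Module R P]
    (x : ℕ →₀ P) : shU R P x 0 = 0 :=
  Finsupp.mapDomain_notin_range _ _ (by simp)

/-- The Shamash construction. -/
noncomputable def DGT.shamash {R : Type} [CommRing R] {P : Type} [AddCommGroup P] [Module R P]
    {l : ℕ} {f : Fin (l + 1) → R} {J : Type} [Fintype J] (S : DGT R P f J) (hf : f 0 = 0) :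
    DGT R (ℕ →₀ P) (f ∘ Fin.succ) (Option J) where
  d := mapK (fun _ => S.d) + mapK (fun _ => S.σ 0) ∘ₗ shD R P
  σ j := mapK (fun _ => S.σ j.succ)
  pr n := mapK (fun k => S.pr (n - 2 * k))
  dd x := by
    ext k
    have h := S.dσ 0 (x (k + 1))
    simp only [hf, zero_smul] at h
    simp [S.dd, S.σsq, h]
  dσ j x := by
    ext k
    have h := S.dσ j.succ (x k)
    have h' := eq_neg_of_add_eq_zero_right (S.σσ j.succ 0 (x (k + 1)))
    simp [h', ← h]
    abel
  σσ i j x := by ext k; simp [S.σσ]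
  σsq j x := by ext k; simp [S.σsq]
  pr_pr m n x := by
    ext k
    by_cases h : m = n
    · simp [h, S.pr_pr]
    · simp [h, S.pr_pr]
  pr_d n x := by
    ext k
    have e1 : n + 1 - 2 * (k : ℤ) = n - 2 * k + 1 := by ring
    have e2 : n + 1 - 2 * ((k + 1 : ℕ) : ℤ) = n - 2 * k - 1 := by push_cast; ring
    simp only [LinearMap.add_apply, LinearMap.comp_apply, mapK_apply, Finsupp.add_apply, map_add,
      shD_apply, S.pr_d, S.pr_σ', e1, e2]
  pr_σ j n x := by
    ext k
    have e1 : n + 1 - 2 * (k : ℤ) = n - 2 * k + 1 := by ring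
    simp only [mapK_apply, S.pr_σ, e1]
  t i := i.elim (shD R P) (fun i => mapK (fun _ => S.t i))
  s i := i.elim (shU R P) (fun i => mapK (fun k => if k = 0 then S.s i else 0))
  n0 := S.n0
  t_d i x := by
    cases i
    · ext k; simp
    · ext k; simp [S.t_d, S.t_σ]
  t_σ i j x := by
    cases i
    · ext k; simp
    · ext k; simp [S.t_σ]
  t_t i j x := by
    cases i <;> cases j
    · ext k; simp
    · ext k; simp
    · ext k; simp
    · ext k; simp [S.t_t]
  pr_t i n x := by
    cases i
    · ext k
      have e : n + 2 - 2 * ((k + 1 : ℕ) : ℤ) = n - 2 * k := by push_cast; ring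
      simp only [Option.elim_none, shD_apply, mapK_apply, e]
    · ext k
      have e : n + 2 - 2 * ((k : ℕ) : ℤ) = n - 2 * k + 2 := by push_cast; ring
      simp only [Option.elim_some, mapK_apply, e, S.pr_t]
  s_t n hn x := by
    rw [Fintype.sum_option]
    ext k
    have h := S.s_t n hn (x 0)
    cases k with
    | zero => simpa [Finsupp.finsetSum_apply] using h
    | succ k => simp [Finsupp.finsetSum_apply]
  pr_neg n hn x := by
    ext k
    simp [S.pr_neg (n - 2 * k) (by omega)]
  fg n := by
    classical
    choose u hu using fun k : ℕ => S.fg (n - 2 * k)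
    refine ⟨(Finset.range (n.toNat + 1)).biUnion fun k => (u k).image (Finsupp.single k), ?_⟩
    rintro _ ⟨x, rfl⟩
    have hx : mapK (fun k => S.pr (n - 2 * k)) x =
        ∑ k ∈ Finset.range (n.toNat + 1), Finsupp.single k (S.pr (n - 2 * k) (x k)) := by
      ext k
      simp only [mapK_apply, Finsupp.finsetSum_apply, Finsupp.single_apply]
      rw [Finset.sum_ite_eq']
      split_ifs with h
      · rfl
      · rw [Finset.mem_range] at h
        exact S.pr_neg _ (by omega) _
    rw [hx]
    refine Submodule.sum_mem _ fun k hk => ?_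
    have h1 : Finsupp.lsingle (R := R) k (S.pr (n - 2 * k) (x k)) ∈
        (Submodule.span R (u k : Set P)).map (Finsupp.lsingle (R := R) k) :=
      Submodule.mem_map_of_mem (hu k ⟨_, rfl⟩)
    rw [Submodule.map_span] at h1
    refine Submodule.span_mono ?_ h1
    rintro _ ⟨y, hy, rfl⟩
    simp only [Finset.coe_biUnion, Finset.coe_image, Set.mem_iUnion]
    exact ⟨k, hk, y, hy, rfl⟩


/-- reduce an endomorphism modulo x -/
def qmap {R : Type} [CommRing R] (x : R) {P : Type} [AddCommGroup P] [Module R P]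
    (φ : P →ₗ[R] P) : QuotSMulTop x P →ₗ[R ⧸ Ideal.span {x}] QuotSMulTop x P :=
  LinearMap.extendScalarsOfSurjective
        (Ideal.Quotient.mk_surjective (I := Ideal.span {x})) (QuotSMulTop.map x φ)

/-- the class of an element -/
abbrev qmk {R : Type} [CommRing R] (x : R) {P : Type} [AddCommGroup P] [Module R P] (p : P) :
    QuotSMulTop x P := Submodule.Quotient.mk p

theorem qmap_mk {R : Type} [CommRing R] (x : R) {P : Type} [AddCommGroup P] [Module R P]
    (φ : P →ₗ[R] P) (p : P) : qmap x φ (qmk x p) = qmk x (φ p) := rfl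

theorem qmk_surj {R : Type} [CommRing R] (x : R) {P : Type} [AddCommGroup P] [Module R P] 
    (y : QuotSMulTop x P) : ∃ p, qmk x p = y := Submodule.Quotient.mk_surjective _ y

theorem qmk_add {R : Type} [CommRing R] (x : R) {P : Type} [AddCommGroup P] [Module R P] (p q : P) :
    qmk x (p + q) = qmk x p + qmk x q := rfl

theorem qmk_sub {R : Type} [CommRing R] (x : R) {P : Type} [AddCommGroup P] [Module R P] (p q : P) :
    qmk x (p - q) = qmk x p - qmk x q := rfl

theorem qmk_zero {R : Type} [CommRing R] (x : R) {P : Type} [AddCommGroup P] [Module R P] :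
    qmk x (0 : P) = 0 := rfl

theorem qmk_smul {R : Type} [CommRing R] (x : R) {P : Type} [AddCommGroup P] [Module R P] (r : R)
    (p : P) : qmk x (r • p) = (Ideal.Quotient.mk (Ideal.span {x}) r) • qmk x p := rfl

theorem qmk_sum {R : Type} [CommRing R] (x : R) {P : Type} [AddCommGroup P] [Module R P] {J : Type}
    (s : Finset J) (p : J → P) : qmk x (∑ j ∈ s, p j) = ∑ j ∈ s, qmk x (p j) :=
  map_sum (Submodule.mkQ _) p s

theorem qmk_eq_zero {R : Type} [CommRing R] (x : R) {P : Type} [AddCommGroup P] [Module R P] (p : P) :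
    qmk x p = 0 ↔ ∃ q, p = x • q := by
  rw [Submodule.Quotient.mk_eq_zero, Submodule.mem_smul_pointwise_iff_exists]
  exact ⟨fun ⟨q, _, h⟩ => ⟨q, h.symm⟩, fun ⟨q, h⟩ => ⟨q, trivial, h.symm⟩⟩

/-- reduction modulo x of a DGT -/
def DGT.red {R : Type} [CommRing R] {P : Type} [AddCommGroup P] [Module R P]
    {l : ℕ} {f : Fin l → R} {J : Type} [Fintype J] (S : DGT R P f J) (x : R) :
    DGT (R ⧸ Ideal.span {x}) (QuotSMulTop x P) (Ideal.Quotient.mk (Ideal.span {x}) ∘ f) J where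
  d := qmap x S.d
  σ j := qmap x (S.σ j)
  pr n := qmap x (S.pr n)
  t j := qmap x (S.t j)
  s j := qmap x (S.s j)
  n0 := S.n0
  dd y := by
    obtain ⟨y, rfl⟩ := qmk_surj x y
    simp only [qmap_mk, S.dd, qmk_zero]
  dσ j y := by
    obtain ⟨y, rfl⟩ := qmk_surj x y
    simp only [qmap_mk, ← qmk_add, S.dσ, qmk_smul, Function.comp]
  σσ i j y := by
    obtain ⟨y, rfl⟩ := qmk_surj x y
    simp only [qmap_mk, ← qmk_add, S.σσ, qmk_zero]
  σsq j y := by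
    obtain ⟨y, rfl⟩ := qmk_surj x y
    simp only [qmap_mk, S.σsq, qmk_zero]
  pr_pr m n y := by
    obtain ⟨y, rfl⟩ := qmk_surj x y
    simp only [qmap_mk, S.pr_pr]
    split_ifs <;> rfl
  pr_d n y := by
    obtain ⟨y, rfl⟩ := qmk_surj x y
    simp only [qmap_mk, S.pr_d]
  pr_σ j n y := by
    obtain ⟨y, rfl⟩ := qmk_surj x y
    simp only [qmap_mk, S.pr_σ]
  t_d i y := by
    obtain ⟨y, rfl⟩ := qmk_surj x y
    simp only [qmap_mk, S.t_d]
  t_σ i j y := by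
    obtain ⟨y, rfl⟩ := qmk_surj x y
    simp only [qmap_mk, S.t_σ]
  t_t i j y := by
    obtain ⟨y, rfl⟩ := qmk_surj x y
    simp only [qmap_mk, S.t_t i j]
  pr_t i n y := by
    obtain ⟨y, rfl⟩ := qmk_surj x y
    simp only [qmap_mk, S.pr_t]
  s_t n hn y := by
    obtain ⟨y, rfl⟩ := qmk_surj x y
    simp only [qmap_mk, ← qmk_sum, S.s_t n hn]
  pr_neg n hn y := by
    obtain ⟨y, rfl⟩ := qmk_surj x y
    simp only [qmap_mk, S.pr_neg n hn, qmk_zero]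
  fg n := by
    classical
    obtain ⟨u, hu⟩ := S.fg n
    refine ⟨u.image (qmk x), ?_⟩
    rintro _ ⟨y, rfl⟩
    obtain ⟨y, rfl⟩ := qmk_surj x y
    rw [qmap_mk]
    have h1 : S.pr n y ∈ Submodule.span R (u : Set P) := hu ⟨y, rfl⟩
    rw [Finset.coe_image]
    generalize S.pr n y = z at h1
    induction h1 using Submodule.span_induction with
    | mem z hz => exact Submodule.subset_span ⟨z, hz, rfl⟩
    | zero => exact zero_mem _
    | add a b _ _ ha hb => exact add_mem ha hb
    | smul r a _ ha => rw [qmk_smul]; exact Submodule.smul_mem _ _ ha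

theorem shamash_exact {R : Type} [CommRing R] {P : Type} [AddCommGroup P] [Module R P]
    {l : ℕ} {f : Fin (l + 1) → R} {J : Type} [Fintype J] (S : DGT R P f J)
    {B : Type} [CommRing B] (ρ : R →+* B) {M : Type} [AddCommGroup M] [Module B M] (ε : P →+ M)
    (h : IsAug S.toDGS ρ ε) (hreg : IsSMulRegular P (f 0))
    (hf0 : Ideal.Quotient.mk (Ideal.span {f 0}) (f 0) = 0)
    (ε₁ : QuotSMulTop (f 0) P →+ M) (hε₁ : ∀ p, ε₁ (qmk (f 0) p) = ε p) (K : ℕ) :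
    ∀ x : ℕ →₀ QuotSMulTop (f 0) P, (∀ k > K, x k = 0) → ((S.red (f 0)).shamash hf0).d x = 0 →
      ε₁ (x 0) = 0 → ∃ y, ((S.red (f 0)).shamash hf0).d y = x := by
  set D := ((S.red (f 0)).shamash hf0).d with hD
  have Dk : ∀ x k, D x k = qmap (f 0) S.d (x k) + qmap (f 0) (S.σ 0) (x (k + 1)) :=
    fun x k => rfl
  have hεσ : ∀ p, ε (S.σ 0 p) = 0 := by
    intro p
    rw [← h.aug_pr, S.pr_σ', S.pr_neg _ (by omega), map_zero, map_zero]
  have hd0 : ∀ p, S.d (S.pr 0 p) = 0 := by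
    intro p
    have := S.pr_d (-1) p
    rw [S.pr_neg _ (by omega)] at this
    norm_num at this
    exact this.symm
  have hεD : ∀ y, ε₁ (D y 0) = 0 := by
    intro y
    rw [Dk]
    obtain ⟨a, ha⟩ := qmk_surj (f 0) (y 0)
    obtain ⟨b, hb⟩ := qmk_surj (f 0) (y (0 + 1))
    rw [← ha, ← hb, qmap_mk, qmap_mk, map_add, hε₁, hε₁, h.aug_d, hεσ, add_zero]
  have DD : ∀ y, D (D y) = 0 := ((S.red (f 0)).shamash hf0).dd
  -- decomposition of cycles
  have dec : ∀ u, S.d u = 0 → ∃ v, u = S.pr 0 u + S.d v := by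
    intro u hu
    obtain ⟨v, hv⟩ := h.exact (u - S.pr 0 u) (by rw [map_sub, hu, hd0, sub_zero])
      (by rw [map_sub, h.aug_pr, sub_self])
    exact ⟨v, by rw [hv]; abel⟩
  -- first reduction
  have red : ∀ (K : ℕ) (x : ℕ →₀ QuotSMulTop (f 0) P), (∀ k > K, x k = 0) → D x = 0 →
      ∃ y w, (∀ k > K, (x - D y) k = 0) ∧ (x - D y) K = qmk (f 0) (S.pr 0 w) := by
    intro K x hx hDx
    obtain ⟨ξ, hξ⟩ := qmk_surj (f 0) (x K)
    have h1 : qmk (f 0) (S.d ξ) = 0 := by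
      have := DFunLike.congr_fun hDx K
      rw [Dk, hx (K + 1) (by omega), ← hξ, map_zero, add_zero, qmap_mk] at this
      exact this
    obtain ⟨u, hu⟩ := (qmk_eq_zero _ _).1 h1
    have hdu : S.d u = 0 := by
      apply hreg
      change f 0 • S.d u = f 0 • 0
      rw [smul_zero, ← map_smul, ← hu, S.dd]
    obtain ⟨v, hv⟩ := dec u hdu
    have hσu : S.d (S.σ 0 u) = f 0 • u := by
      have := S.dσ 0 u
      rwa [hdu, map_zero, add_zero] at this
    obtain ⟨w, hw⟩ := dec (ξ - S.σ 0 u) (by rw [map_sub, hu, hσu, sub_self])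
    have hσdv : S.σ 0 (S.d v) = f 0 • v - S.d (S.σ 0 v) := by
      rw [← S.dσ 0 v]; abel
    have hξ' : ξ = S.pr 0 (ξ - S.σ 0 u) + (S.d (w - S.σ 0 v) + S.σ 0 (S.pr 0 u)) + f 0 • v := by
      have e1 : S.σ 0 u = S.σ 0 (S.pr 0 u) + S.σ 0 (S.d v) := by rw [← map_add, ← hv]
      have e2 : ξ = S.pr 0 (ξ - S.σ 0 u) + S.d w + S.σ 0 u := by rw [← hw]; abel
      rw [hσdv] at e1
      conv_lhs => rw [e2]
      conv_lhs => arg 2; rw [e1]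
      rw [map_sub S.d]; abel
    have hfv : qmk (f 0) (f 0 • v) = 0 := (qmk_eq_zero _ _).2 ⟨v, rfl⟩
    refine ⟨Finsupp.single K (qmk (f 0) (w - S.σ 0 v)) +
      Finsupp.single (K + 1) (qmk (f 0) (S.pr 0 u)), ξ - S.σ 0 u, ?_, ?_⟩
    · intro k hk
      rw [Finsupp.sub_apply, Dk, hx k hk]
      have e1 : Finsupp.single K (qmk (f 0) (w - S.σ 0 v)) k = 0 :=
        Finsupp.single_eq_of_ne (by omega)
      have e2 : Finsupp.single K (qmk (f 0) (w - S.σ 0 v)) (k + 1) = 0 :=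
        Finsupp.single_eq_of_ne (by omega)
      have e3 : Finsupp.single (K + 1) (qmk (f 0) (S.pr 0 u)) (k + 1) = 0 :=
        Finsupp.single_eq_of_ne (by omega)
      simp only [Finsupp.add_apply, e1, e2, e3, zero_add, map_zero, add_zero, zero_sub, neg_eq_zero]
      by_cases hk' : k = K + 1
      · rw [hk', Finsupp.single_eq_same, qmap_mk, hd0, qmk_zero]
      · rw [Finsupp.single_eq_of_ne hk', map_zero]
    · rw [Finsupp.sub_apply, Dk]
      have e2 : Finsupp.single K (qmk (f 0) (w - S.σ 0 v)) (K + 1) = 0 :=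
        Finsupp.single_eq_of_ne (by omega)
      have e3 : Finsupp.single (K + 1) (qmk (f 0) (S.pr 0 u)) K = 0 :=
        Finsupp.single_eq_of_ne (by omega)
      simp only [Finsupp.add_apply, e2, e3, zero_add, add_zero, Finsupp.single_eq_same]
      rw [← hξ, qmap_mk, qmap_mk]
      conv_lhs => rw [hξ']
      rw [qmk_add, qmk_add, hfv, qmk_add]; abel
  induction K with
  | zero =>
    intro x hx hDx hεx
    obtain ⟨y, w, h1, h2⟩ := red 0 x hx hDx
    have hw : ε (S.pr 0 w) = 0 := by
      rw [← hε₁, ← h2, Finsupp.sub_apply, map_sub, hεx, hεD, sub_zero]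
    obtain ⟨z, hz⟩ := h.exact _ (hd0 w) hw
    refine ⟨y + Finsupp.single 0 (qmk (f 0) z), ?_⟩
    rw [map_add]
    apply eq_of_sub_eq_zero
    rw [← neg_eq_zero]
    ext k
    have h3 : (x - D y) k = D (Finsupp.single 0 (qmk (f 0) z)) k := by
      rw [Dk, Finsupp.single_eq_of_ne (a := 0) (a' := k + 1) (by omega), map_zero, add_zero]
      by_cases hk : k = 0
      · rw [hk, h2, Finsupp.single_eq_same, qmap_mk, hz]
      · rw [h1 k (by omega), Finsupp.single_eq_of_ne hk, map_zero]
    have h4 : -(D y + D (Finsupp.single 0 (qmk (f 0) z)) - x) =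
      (x - D y) - D (Finsupp.single 0 (qmk (f 0) z)) := by abel
    rw [h4, Finsupp.sub_apply, h3, sub_self]; rfl
  | succ K ih =>
    intro x hx hDx hεx
    obtain ⟨y, w, h1, h2⟩ := red (K + 1) x hx hDx
    set x' := x - D y with hx'
    have hDx' : D x' = 0 := by rw [hx', map_sub, hDx, DD, sub_zero]
    obtain ⟨ξ, hξ⟩ := qmk_surj (f 0) (x' K)
    have h3 : qmk (f 0) (S.d ξ + S.σ 0 (S.pr 0 w)) = 0 := by
      have := DFunLike.congr_fun hDx' K
      rw [Dk, h2, ← hξ, qmap_mk, qmap_mk] at this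
      exact this
    obtain ⟨z, hz⟩ := (qmk_eq_zero _ _).1 h3
    have hzw : S.d z = S.pr 0 w := by
      apply hreg
      change f 0 • _ = f 0 • _
      rw [← map_smul, ← hz, map_add, S.dd, zero_add]
      have := S.dσ 0 (S.pr 0 w)
      rwa [hd0, map_zero, add_zero] at this
    obtain ⟨y', hy'⟩ := ih (x' - D (Finsupp.single (K + 1) (qmk (f 0) z))) (by
        intro k hk
        rw [Finsupp.sub_apply, Dk, Finsupp.single_eq_of_ne (a := K + 1) (a' := k + 1) (by omega),
          map_zero, add_zero]
        by_cases hk' : k = K + 1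
        · rw [hk', h2, Finsupp.single_eq_same, qmap_mk, hzw, sub_self]
        · rw [h1 k (by omega), Finsupp.single_eq_of_ne hk', map_zero, sub_zero])
      (by rw [map_sub, hDx', DD, sub_zero])
      (by rw [hx', Finsupp.sub_apply, Finsupp.sub_apply, map_sub, map_sub, hεx, hεD, hεD]; simp)
    refine ⟨y' + Finsupp.single (K + 1) (qmk (f 0) z) + y, ?_⟩
    rw [map_add, map_add, hy', hx']; abel


theorem proj_finsupp {R : Type} [CommRing R] (P : Type) [AddCommGroup P] [Module R P]
    [Module.Projective R P] : Module.Projective R (ℕ →₀ P) := by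
  classical
  exact Module.Projective.of_equiv (finsuppLequivDFinsupp (ι := ℕ) (M := P) R).symm

theorem proj_quotSMulTop {R : Type} [CommRing R] (x : R) (P : Type) [AddCommGroup P] [Module R P]
    [Module.Projective R P] : Module.Projective (R ⧸ Ideal.span {x}) (QuotSMulTop x P) :=
  Module.Projective.of_equiv ((QuotSMulTop.equivQuotTensor x P).symm.extendScalarsOfSurjective
    (Ideal.Quotient.mk_surjective (I := Ideal.span {x})))

/-- the augmentation modulo x -/
def augQ {R : Type} [CommRing R] {P : Type} [AddCommGroup P] [Module R P] (x : R)
    {M : Type} [AddCommGroup M] (ε : P →+ M) (h : ∀ p, ε (x • p) = 0) : QuotSMulTop x P →+ M :=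
  QuotientAddGroup.lift _ ε (by
    intro y hy
    obtain ⟨q, _, rfl⟩ := (Submodule.mem_smul_pointwise_iff_exists _ _ _).1 hy
    exact h q)

theorem augQ_mk {R : Type} [CommRing R] {P : Type} [AddCommGroup P] [Module R P] (x : R)
    {M : Type} [AddCommGroup M] (ε : P →+ M) (h : ∀ p, ε (x • p) = 0) (p : P) :
    augQ x ε h (qmk x p) = ε p := rfl

theorem wreg_quot {R : Type} [CommRing R] (r : R) (rs : List R)
    (h : RingTheory.Sequence.IsWeaklyRegular R (r :: rs)) : IsSMulRegular R r ∧
    RingTheory.Sequence.IsWeaklyRegular (R ⧸ Ideal.span {r})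
      (List.map (Ideal.Quotient.mk (Ideal.span {r})) rs) := by
  obtain ⟨h1, h2⟩ := (RingTheory.Sequence.isWeaklyRegular_cons_iff' R r rs).1 h
  refine ⟨h1, ?_⟩
  have e : QuotSMulTop r R ≃ₗ[R] (R ⧸ Ideal.span {r}) :=
    (QuotSMulTop.equivQuotTensor r R).trans (TensorProduct.rid R _)
  exact ((e.extendScalarsOfSurjective
    (Ideal.Quotient.mk_surjective (I := Ideal.span {r}))).isWeaklyRegular_congr _).1 h2

/-- transport along a ring isomorphism -/
theorem DGT.transport {R : Type} [CommRing R] {P : Type} [AddCommGroup P] [Module R P]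
    [Module.Projective R P]
    {f : Fin 0 → R} {J : Type} [Fintype J] (S : DGT R P f J) {B : Type} [CommRing B] (e : R ≃+* B)
    {M : Type} [AddCommGroup M] [Module B M] (ε : P →+ M)
    (h : IsAug S.toDGS (e : R →+* B) ε) (g : Fin 0 → B) :
    ∃ (_ : Module B P) (_ : Module.Projective B P) (S' : DGT B P g J),
      IsAug S'.toDGS (RingHom.id B) ε := by
  letI : Module B P := Module.compHom P (e.symm : B →+* R)
  have hsm : ∀ (b : B) (p : P), b • p = e.symm b • p := fun _ _ => rfl
  have cv : ∀ φ : P →ₗ[R] P, ∃ ψ : P →ₗ[B] P, ∀ x, ψ x = φ x := fun φ =>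
    ⟨{ toFun := φ, map_add' := map_add φ, map_smul' := fun b x => by simp [hsm] }, fun _ => rfl⟩
  choose cv hcv using cv
  refine ⟨inferInstance, ?_, ?_⟩
  · letI := RingHomInvPair.of_ringEquiv e
    letI := RingHomInvPair.symm (e : R →+* B) (e.symm : B →+* R)
    let E : P ≃ₛₗ[(e : R →+* B)] P :=
      { toFun := id, invFun := id, left_inv := fun _ => rfl, right_inv := fun _ => rfl,
        map_add' := fun _ _ => rfl
        map_smul' := fun r x => by simp [hsm] }
    exact Module.Projective.of_equiv E
  · refine ⟨{ d := cv S.d, σ := fun j => cv (S.σ j), pr := fun n => cv (S.pr n),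
              t := fun j => cv (S.t j), s := fun j => cv (S.s j), n0 := S.n0,
              dd := ?_, dσ := fun j => j.elim0, σσ := fun j => j.elim0, σsq := fun j => j.elim0,
              pr_pr := ?_, pr_d := ?_, pr_σ := fun j => j.elim0, t_d := ?_,
              t_σ := fun _ j => j.elim0, t_t := ?_, pr_t := ?_, s_t := ?_, pr_neg := ?_,
              fg := ?_ }, ?_⟩
    · simp only [hcv]; exact S.dd
    · simp only [hcv]; exact S.pr_pr
    · simp only [hcv]; exact S.pr_d
    · simp only [hcv]; exact S.t_d
    · simp only [hcv]; exact S.t_t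
    · simp only [hcv]; exact S.pr_t
    · simp only [hcv]; exact S.s_t
    · simp only [hcv]; exact S.pr_neg
    · intro n
      obtain ⟨u, hu⟩ := S.fg n
      refine ⟨u, ?_⟩
      rintro _ ⟨y, rfl⟩
      rw [hcv]
      have h1 : S.pr n y ∈ Submodule.span R (u : Set P) := hu ⟨y, rfl⟩
      generalize S.pr n y = z at h1
      induction h1 using Submodule.span_induction with
      | mem z hz => exact Submodule.subset_span hz
      | zero => exact zero_mem _
      | add a b _ _ ha hb => exact add_mem ha hb
      | smul r a _ ha =>
        have : r • a = (e r) • a := by rw [hsm, e.symm_apply_apply]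
        rw [this]; exact Submodule.smul_mem _ _ ha
    · refine ⟨fun b x => ?_, h.surj, ?_, ?_, ?_⟩
      · rw [hsm, h.smul]; simp
      · simp only [hcv]; exact h.aug_d
      · simp only [hcv]; exact h.aug_pr
      · simp only [hcv]; exact h.exact

theorem DGT.exists_final {B : Type} [CommRing B] {M : Type} [AddCommGroup M] [Module B M] (l : ℕ) :
    ∀ (R : Type) [CommRing R] (P : Type) [AddCommGroup P] [Module R P] [Module.Projective R P]
    (f : Fin l → R) (J : Type) [Fintype J] (S : DGT R P f J) (ρ : R →+* B)
    (_ : Function.Surjective ρ) (_ : RingHom.ker ρ = Ideal.span (Set.range f))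
    (_ : RingTheory.Sequence.IsWeaklyRegular R (List.ofFn f))
    (ε : P →+ M) (_ : IsAug S.toDGS ρ ε) (g : Fin 0 → B),
    ∃ (P' : Type) (_ : AddCommGroup P') (_ : Module B P') (_ : Module.Projective B P')
      (J' : Type) (_ : Fintype J') (S' : DGT B P' g J') (ε' : P' →+ M),
      IsAug S'.toDGS (RingHom.id B) ε' := by
  induction l with
  | zero =>
    intro R _ P _ _ _ f J _ S ρ hρ hker hreg ε hε g
    have hinj : Function.Injective ρ := by
      rw [RingHom.injective_iff_ker_eq_bot, hker]
      simp
    obtain ⟨i1, i2, S', h'⟩ := S.transport (RingEquiv.ofBijective ρ ⟨hinj, hρ⟩) ε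
      (by
        have e : ((RingEquiv.ofBijective ρ ⟨hinj, hρ⟩ : R ≃+* B) : R →+* B) = ρ := by ext; rfl
        rw [e]; exact hε) g
    exact ⟨P, inferInstance, i1, i2, J, inferInstance, S', ε, h'⟩
  | succ l ih =>
    intro R _ P _ _ _ f J _ S ρ hρ hker hreg ε hε g
    rw [List.ofFn_succ] at hreg
    obtain ⟨h1, h2⟩ := wreg_quot _ _ hreg
    have hρf : ∀ j, ρ (f j) = 0 := fun j => by
      have : f j ∈ RingHom.ker ρ := hker ▸ Ideal.subset_span ⟨j, rfl⟩
      exact this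
    have hf0 : Ideal.Quotient.mk (Ideal.span {f 0}) (f 0) = 0 :=
      Ideal.Quotient.eq_zero_iff_mem.2 (Ideal.subset_span rfl)
    have hεf : ∀ p, ε (f 0 • p) = 0 := fun p => by rw [hε.smul, hρf, zero_smul]
    haveI := proj_quotSMulTop (f 0) P
    haveI := proj_finsupp (R := R ⧸ Ideal.span {f 0}) (QuotSMulTop (f 0) P)
    have hle : ∀ a ∈ Ideal.span {f 0}, ρ a = 0 := fun a ha => by
      have : Ideal.span {f 0} ≤ RingHom.ker ρ := by
        rw [Ideal.span_le]; rintro _ rfl; exact hρf 0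
      exact this ha
    set ρ₁ := Ideal.Quotient.lift (Ideal.span {f 0}) ρ hle with hρ₁
    set ε₁ := augQ (f 0) ε hεf with hε₁
    let ε' : (ℕ →₀ QuotSMulTop (f 0) P) →+ M := ε₁.comp (Finsupp.applyAddHom 0)
    have hε' : ∀ x, ε' x = ε₁ (x 0) := fun x => rfl
    refine ih (R ⧸ Ideal.span {f 0}) (ℕ →₀ QuotSMulTop (f 0) P) _ (Option J)
      ((S.red (f 0)).shamash hf0) ρ₁ ?_ ?_ ?_ ε' ?_ g
    · intro b
      obtain ⟨r, rfl⟩ := hρ b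
      exact ⟨Ideal.Quotient.mk _ r, rfl⟩
    · apply le_antisymm
      · intro a ha
        obtain ⟨r, rfl⟩ := Ideal.Quotient.mk_surjective a
        have hr : r ∈ Ideal.span (Set.range f) := hker ▸ (show r ∈ RingHom.ker ρ from ha)
        have h3 := Ideal.mem_map_of_mem (Ideal.Quotient.mk (Ideal.span {f 0})) hr
        rw [Ideal.map_span] at h3
        refine (Ideal.span_le.2 ?_) h3
        rintro _ ⟨_, ⟨j, rfl⟩, rfl⟩
        refine Fin.cases ?_ (fun j => ?_) j
        · rw [hf0]; exact zero_mem _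
        · exact Ideal.subset_span ⟨j, rfl⟩
      · rw [Ideal.span_le]
        rintro _ ⟨j, rfl⟩
        exact hρf _
    · rw [List.map_ofFn] at h2
      exact h2
    · have hsurj := hε.surj
      constructor
      · intro r x
        obtain ⟨r, rfl⟩ := Ideal.Quotient.mk_surjective r
        obtain ⟨a, ha⟩ := qmk_surj (f 0) (x 0)
        rw [hε', hε', Finsupp.smul_apply, ← ha, ← qmk_smul]
        exact hε.smul r a
      · intro m
        obtain ⟨p, rfl⟩ := hε.surj m
        refine ⟨Finsupp.single 0 (qmk (f 0) p), ?_⟩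
        rw [hε', Finsupp.single_eq_same]; rfl
      · intro x
        obtain ⟨a, ha⟩ := qmk_surj (f 0) (x 0)
        obtain ⟨b, hb⟩ := qmk_surj (f 0) (x (0 + 1))
        have : ((S.red (f 0)).shamash hf0).d x 0 =
          qmap (f 0) S.d (x 0) + qmap (f 0) (S.σ 0) (x (0 + 1)) := rfl
        rw [hε', this, ← ha, ← hb, qmap_mk, qmap_mk, map_add]
        change ε _ + ε _ = 0
        rw [hε.aug_d, zero_add]
        rw [← hε.aug_pr, S.pr_σ', S.pr_neg _ (by omega), map_zero, map_zero]
      · intro x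
        obtain ⟨a, ha⟩ := qmk_surj (f 0) (x 0)
        have : ((S.red (f 0)).shamash hf0).pr 0 x 0 = qmap (f 0) (S.pr (0 - 2 * ((0 : ℕ) : ℤ))) (x 0) := rfl
        rw [hε', hε', this, ← ha, qmap_mk]
        exact hε.aug_pr a
      · intro x hx hx0
        obtain ⟨K, hK⟩ : ∃ K, ∀ k > K, x k = 0 := by
          refine ⟨x.support.sup id, fun k hk => ?_⟩
          by_contra hne
          have := Finset.le_sup (f := id) (Finsupp.mem_support_iff.2 hne)
          simp at this
          omega
        exact shamash_exact S ρ ε hε (smulReg_of_projective h1 P) hf0 ε₁ (fun _ => rfl) K x hK hx hx0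

theorem DGT.exists_main {R : Type} [CommRing R] [IsNoetherianRing R] {B : Type} [CommRing B]
    (π : R →+* B) (hπ : Function.Surjective π) (c : ℕ) (f : Fin c → R)
    (hreg : RingTheory.Sequence.IsWeaklyRegular R (List.ofFn f))
    (hker : RingHom.ker π = Ideal.span (Set.range f)) (N : ℕ)
    (hPd : ∀ (M : Type) [AddCommGroup M] [Module R M] [Module.Finite R M], PdLE R (N + 1) M)
    (M : Type) [AddCommGroup M] [Module B M] [Module.Finite B M] (g : Fin 0 → B) :
    ∃ (P' : Type) (_ : AddCommGroup P') (_ : Module B P') (_ : Module.Projective B P')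
      (J' : Type) (_ : Fintype J') (S' : DGT B P' g J') (ε' : P' →+ M),
      IsAug S'.toDGS (RingHom.id B) ε' := by
  letI : Module R M := Module.compHom M π
  letI : Algebra R B := π.toAlgebra
  haveI : IsScalarTower R B M := ⟨fun r b m => by
    change (π r * b) • m = π r • b • m
    rw [mul_smul]⟩
  haveI : Module.Finite R B := Module.Finite.of_surjective (Algebra.linearMap R B) hπ
  haveI : Module.Finite R M := Module.Finite.trans B M
  have hfM : ∀ j (m : M), f j • m = 0 := fun j m => by
    change π (f j) • m = 0
    have : f j ∈ RingHom.ker π := hker ▸ Ideal.subset_span ⟨j, rfl⟩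
    rw [RingHom.mem_ker.1 this, zero_smul]
  obtain ⟨P, _, _, hfin, _, S, ε, h1, h2, h3, h4, h5, h6⟩ := DGS.exists_base f M hfM N (hPd M)
  let T : DGT R P f Empty :=
    { toDGS := S
      t := fun j => j.elim, s := fun j => j.elim
      n0 := N + 1
      t_d := fun j => j.elim, t_σ := fun j => j.elim, t_t := fun j => j.elim,
      pr_t := fun j => j.elim
      s_t := fun n hn x => by rw [h5 n hn x]; simp
      pr_neg := h4
      fg := fun n => by
        obtain ⟨u, hu⟩ := hfin.fg_top
        exact ⟨u, by rw [hu]; exact le_top⟩ }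
  exact DGT.exists_final c R P f Empty T π hπ hker hreg ε.toAddMonoidHom
    ⟨fun r x => ε.map_smul r x, h1, h2, h3, h6⟩ g


/-- primes of A which are of the form (W : z) for some z in Z -/
def AssZ {A B : Type} [CommRing A] [CommRing B] (φ : A →+* B) {E : Type} [AddCommGroup E]
    [Module B E] (Z W : Submodule B E) : Set (Ideal A) :=
  {p | p.IsPrime ∧ ∃ z ∈ Z, ∀ a, a ∈ p ↔ φ a • z ∈ W}

theorem assC_finite {A S : Type} [CommRing A] [CommRing S] [IsNoetherianRing S] (ψ : A →+* S)
    (U : Type) [AddCommGroup U] [Module S U] [Module.Finite S U] :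
    {p : Ideal A | p.IsPrime ∧ ∃ h : U, ∀ a, a ∈ p ↔ ψ a • h = 0}.Finite := by
  refine ((associatedPrimes.finite S U).image (Ideal.comap ψ)).subset ?_
  rintro p ⟨hp, h, hh⟩
  let good : S → Prop := fun s => ∀ a, ψ a • s • h = 0 → a ∈ p
  let F : Set (Ideal S) := {I | ∃ s, good s ∧ I = LinearMap.ker (LinearMap.toSpanSingleton S U (s • h))}
  have hmemI : ∀ s u : S, u ∈ LinearMap.ker (LinearMap.toSpanSingleton S U (s • h)) ↔ u • s • h = 0 :=
    fun s u => by simp [LinearMap.mem_ker]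
  have hF : F.Nonempty := ⟨_, 1, fun a ha => (hh a).2 (by rwa [one_smul] at ha), rfl⟩
  obtain ⟨I, ⟨s, hs, rfl⟩, hmax⟩ := set_has_maximal_iff_noetherian.2
    (inferInstance : IsNoetherian S S) F hF
  have hmax' : ∀ s' : S, good s' → (∀ u : S, u • s • h = 0 → u • s' • h = 0) →
      ∀ u : S, u • s' • h = 0 → u • s • h = 0 := by
    intro s' hs' hle u hu
    by_contra hne
    apply hmax _ ⟨s', hs', rfl⟩
    refine lt_of_le_of_ne (fun v hv => (hmemI _ _).2 (hle v ((hmemI _ _).1 hv))) ?_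
    intro he
    exact hne ((hmemI _ _).1 (he ▸ (hmemI _ _).2 hu))
  refine ⟨LinearMap.ker (LinearMap.toSpanSingleton S U (s • h)), ?_, ?_⟩
  · rw [AssociatedPrimes.mem_iff, isAssociatedPrime_iff]
    refine ⟨⟨?_, ?_⟩, s • h, ?_⟩
    · rw [Ideal.ne_top_iff_one, hmemI]
      intro h1
      exact hp.ne_top ((Ideal.eq_top_iff_one _).2 (hs 1 (by rwa [map_one])))
    · intro u v huv
      rw [hmemI] at huv
      rw [hmemI, hmemI]
      by_contra hcon
      push Not at hcon
      obtain ⟨hu, hv⟩ := hcon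
      by_cases hg : good (u * s)
      · refine hv (hmax' (u * s) hg ?_ v ?_)
        · intro w hw
          rw [mul_smul, smul_comm, hw, smul_zero]
        · rw [mul_smul, smul_smul, mul_comm v u]; exact huv
      · simp only [good] at hg
        push Not at hg
        obtain ⟨a, ha, hap⟩ := hg
        refine hu (hmax' (ψ a * s) ?_ ?_ u ?_)
        · intro b hb
          have : ψ (b * a) • s • h = 0 := by rw [map_mul, mul_smul, ← hb, ← mul_smul (ψ a)]
          exact (hp.mem_or_mem (hs _ this)).resolve_right hap
        · intro w hw
          rw [mul_smul, smul_comm, hw, smul_zero]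
        · rw [mul_smul, smul_comm, ← mul_smul u, ha]
    · ext u
      rw [hmemI, Submodule.mem_colon_singleton, Submodule.mem_bot]
  · ext a
    rw [Ideal.mem_comap, hmemI]
    refine ⟨hs a, fun ha => ?_⟩
    rw [smul_comm, (hh a).1 ha, smul_zero]

theorem hilb {B W : Type} [CommRing B] [IsNoetherianRing B] [AddCommGroup W] [Module B W]
    (G : Set (Module.End B W)) (hG : G.Finite) (comm : ∀ a ∈ G, ∀ b ∈ G, a * b = b * a)
    (V : Submodule B W) (hV : ∀ a ∈ G, ∀ z ∈ V, a z ∈ V) (g : Finset W) (hgV : ∀ z ∈ g, z ∈ V)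
    (hg : ∀ U : Submodule B W, (∀ a ∈ G, ∀ z ∈ U, a z ∈ U) → (∀ z ∈ g, z ∈ U) → V ≤ U) :
    (∀ U : ℕ →o Submodule B W, (∀ m, ∀ a ∈ G, ∀ z ∈ U m, a z ∈ U m) → (∀ m, U m ≤ V) →
      ∃ m0, ∀ m ≥ m0, U m = U m0) ∧
    (∀ U : Submodule B W, (∀ a ∈ G, ∀ z ∈ U, a z ∈ U) →
      ∀ (A : Type) [CommRing A] (φ : A →+* B), (AssZ φ V U).Finite) := by
  let S := Algebra.adjoin B G
  letI : CommRing S := Algebra.adjoinCommRingOfComm B comm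
  have hsm : ∀ (s : S) (w : W), s • w = (s : Module.End B W) w := fun _ _ => rfl
  have hst : ∀ U : Submodule B W, (∀ a ∈ G, ∀ z ∈ U, a z ∈ U) → ∀ (s : S), ∀ z ∈ U, s • z ∈ U := by
    rintro U hU ⟨s, hs⟩
    induction hs using Algebra.adjoin_induction with
    | mem x hx => exact hU x hx
    | algebraMap r => exact fun z hz => U.smul_mem r hz
    | add x y _ _ hx hy => exact fun z hz => U.add_mem (hx z hz) (hy z hz)
    | mul x y _ _ hx hy => exact fun z hz => hx _ (hy z hz)
  let toS : ∀ U : Submodule B W, (∀ a ∈ G, ∀ z ∈ U, a z ∈ U) → Submodule S W := fun U hU =>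
    { carrier := U, add_mem' := U.add_mem, zero_mem' := U.zero_mem
      smul_mem' := fun s z hz => hst U hU s z hz }
  haveI : Algebra.FiniteType B S := by
    rw [← Subalgebra.fg_iff_finiteType]
    exact Subalgebra.fg_def.2 ⟨G, hG, rfl⟩
  haveI : IsNoetherianRing S := Algebra.FiniteType.isNoetherianRing B S
  have hfg : (toS V hV).FG := by
    refine ⟨g, le_antisymm ?_ ?_⟩
    · rw [Submodule.span_le]; exact hgV
    · intro z hz
      let U : Submodule B W :=
        { carrier := Submodule.span S (g : Set W)
          add_mem' := Submodule.add_mem _, zero_mem' := Submodule.zero_mem _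
          smul_mem' := fun b z hz => by
            have : b • z = (algebraMap B S b) • z := rfl
            rw [this]; exact Submodule.smul_mem _ _ hz }
      exact hg U (fun a ha z hz => Submodule.smul_mem (Submodule.span S (g : Set W))
        (⟨a, Algebra.subset_adjoin ha⟩ : S) hz) (fun z hz => Submodule.subset_span hz) hz
  haveI : Module.Finite S (toS V hV) := Module.Finite.iff_fg.2 hfg
  constructor
  · intro U hU hUV
    let F : ℕ →o Submodule S (toS V hV) :=
      { toFun := fun m => (toS (U m) (hU m)).comap (toS V hV).subtype
        monotone' := fun m n hmn z hz => U.monotone hmn hz }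
    obtain ⟨m0, h0⟩ := monotone_stabilizes_iff_noetherian.2
      (inferInstance : IsNoetherian S (toS V hV)) F
    refine ⟨m0, fun m hm => le_antisymm (fun z hz => ?_) (U.monotone hm)⟩
    have h1 : (⟨z, hUV m hz⟩ : toS V hV) ∈ F m := hz
    rw [← h0 m hm] at h1
    exact h1
  · intro U hU A _ φ
    let K : Submodule S (toS V hV) := (toS U hU).comap (toS V hV).subtype
    refine (assC_finite ((algebraMap B S).comp φ) ((toS V hV) ⧸ K)).subset ?_
    rintro p ⟨hp, z, hz, h⟩
    refine ⟨hp, Submodule.Quotient.mk ⟨z, hz⟩, fun a => ?_⟩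
    rw [h, ← Submodule.Quotient.mk_smul, Submodule.Quotient.mk_eq_zero]
    exact Iff.rfl


/-- homogeneous operator on finitely supported families -/
noncomputable def opS {B E : Type} [CommRing B] [AddCommGroup E] [Module B E] (φ : E →ₗ[B] E)
    (v : ℕ × ℕ) : Module.End B (ℕ × ℕ →₀ E) :=
  (Finsupp.mapRange.linearMap φ).comp (Finsupp.lmapDomain E B (fun q => q + v))

theorem opS_single {B E : Type} [CommRing B] [AddCommGroup E] [Module B E] (φ : E →ₗ[B] E)
    (v q : ℕ × ℕ) (e : E) :
    opS φ v (Finsupp.single q e) = Finsupp.single (q + v) (φ e) := by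
  simp [opS]

theorem opS_comm {B E : Type} [CommRing B] [AddCommGroup E] [Module B E] (φ ψ : E →ₗ[B] E)
    (h : ∀ e, φ (ψ e) = ψ (φ e)) (v w : ℕ × ℕ) : opS φ v * opS ψ w = opS ψ w * opS φ v := by
  refine Finsupp.lhom_ext fun q e => ?_
  rw [Module.End.mul_apply, Module.End.mul_apply, opS_single, opS_single, opS_single, opS_single,
    h, add_assoc, add_assoc, add_comm v w]

/-- families with values in given submodules -/
def GrS {B E : Type} [CommRing B] [AddCommGroup E] [Module B E] (K : ℕ × ℕ → Submodule B E) :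
    Submodule B (ℕ × ℕ →₀ E) where
  carrier := {w | ∀ q, w q ∈ K q}
  add_mem' ha hb q := (K q).add_mem (ha q) (hb q)
  zero_mem' q := (K q).zero_mem
  smul_mem' b _ ha q := (K q).smul_mem b (ha q)

theorem single_mem_GrS {B E : Type} [CommRing B] [AddCommGroup E] [Module B E]
    (K : ℕ × ℕ → Submodule B E) (q : ℕ × ℕ) (e : E) : Finsupp.single q e ∈ GrS K ↔ e ∈ K q := by
  classical
  constructor
  · intro h
    simpa using h q
  · intro h r
    by_cases hr : r = q
    · subst hr; simpa using h
    · rw [Finsupp.single_eq_of_ne hr]; exact zero_mem _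

theorem GrS_le {B E : Type} [CommRing B] [AddCommGroup E] [Module B E]
    (K : ℕ × ℕ → Submodule B E) (U : Submodule B (ℕ × ℕ →₀ E))
    (h : ∀ q, ∀ e ∈ K q, Finsupp.single q e ∈ U) : GrS K ≤ U := by
  intro w hw
  rw [← w.sum_single]
  exact Submodule.sum_mem _ fun q _ => h q _ (hw q)

theorem opS_GrS {B E : Type} [CommRing B] [AddCommGroup E] [Module B E]
    (K : ℕ × ℕ → Submodule B E) (φ : E →ₗ[B] E) (v : ℕ × ℕ) (h : ∀ q, ∀ e ∈ K q, φ e ∈ K (q + v)) :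
    ∀ z ∈ GrS K, opS φ v z ∈ GrS K := by
  intro z hz
  have : GrS K ≤ (GrS K).comap (opS φ v) := by
    refine GrS_le _ _ fun q e he => ?_
    rw [Submodule.mem_comap, opS_single, single_mem_GrS]
    exact h q e he
  exact this hz

theorem bigraded_noeth {B E : Type} [CommRing B] [IsNoetherianRing B] [AddCommGroup E] [Module B E]
    {κ ι : Type} [Finite κ] [Finite ι] (t : κ → E →ₗ[B] E) (x : ι → B)
    (C : ℕ × ℕ → Submodule B E) (tt : ∀ i j e, t i (t j e) = t j (t i e))
    (hCt : ∀ j q, ∀ e ∈ C q, t j e ∈ C (q + (2, 0))) (hCx : ∀ j q, ∀ e ∈ C q, x j • e ∈ C (q + (0, 1)))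
    (hfg : ∀ q, (C q).FG) (i1 : ℕ)
    (hX : ∀ q, ∀ e ∈ C (q + (0, 1)), ∀ U : Submodule B E,
      (∀ j, ∀ z ∈ C q, x j • z ∈ U) → e ∈ U)
    (hT : ∀ q : ℕ × ℕ, i1 ≤ q.1 → ∀ e ∈ C (q + (2, 0)), ∀ U : Submodule B E,
      (∀ j, ∀ z ∈ C q, t j z ∈ U) → e ∈ U) :
    (∀ K : ℕ → ℕ × ℕ → Submodule B E, Monotone K → (∀ m q, K m q ≤ C q) →
      (∀ m j q, ∀ e ∈ K m q, t j e ∈ K m (q + (2, 0))) →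
      (∀ m j q, ∀ e ∈ K m q, x j • e ∈ K m (q + (0, 1))) → ∃ m0, ∀ m ≥ m0, K m = K m0) ∧
    (∀ K : ℕ × ℕ → Submodule B E,
      (∀ j q, ∀ e ∈ K q, t j e ∈ K (q + (2, 0))) →
      (∀ j q, ∀ e ∈ K q, x j • e ∈ K (q + (0, 1))) →
      ∀ (A : Type) [CommRing A] (φ : A →+* B), (⋃ q, AssZ φ (C q) (K q)).Finite) := by
  classical
  let xl : ι → E →ₗ[B] E := fun j => x j • LinearMap.id
  have hxl : ∀ j e, xl j e = x j • e := fun _ _ => rfl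
  let G : Set (Module.End B (ℕ × ℕ →₀ E)) :=
    Set.range (fun j => opS (t j) (2, 0)) ∪ Set.range (fun j => opS (xl j) (0, 1))
  have hstab : ∀ K : ℕ × ℕ → Submodule B E,
      (∀ j q, ∀ e ∈ K q, t j e ∈ K (q + (2, 0))) →
      (∀ j q, ∀ e ∈ K q, x j • e ∈ K (q + (0, 1))) → ∀ a ∈ G, ∀ z ∈ GrS K, a z ∈ GrS K := by
    rintro K h1 h2 a (⟨j, rfl⟩ | ⟨j, rfl⟩)
    · exact opS_GrS K _ _ (h1 j)
    · exact opS_GrS K _ _ (h2 j)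
  choose u hu using fun i : ℕ => hfg (i, 0)
  have key := hilb G ((Set.finite_range _).union (Set.finite_range _)) (by
      rintro a (⟨i, rfl⟩ | ⟨i, rfl⟩) b (⟨j, rfl⟩ | ⟨j, rfl⟩)
      · exact opS_comm _ _ (tt i j) _ _
      · exact opS_comm _ _ (fun e => by simp [hxl]) _ _
      · exact opS_comm _ _ (fun e => by simp [hxl]) _ _
      · exact opS_comm _ _ (fun e => by rw [hxl, hxl, hxl, hxl, smul_comm]) _ _)
    (GrS C) (hstab C hCt hCx)
    ((Finset.range (i1 + 2)).biUnion fun i => (u i).image (Finsupp.single (i, 0))) (by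
      intro z hz
      simp only [Finset.mem_biUnion, Finset.mem_image] at hz
      obtain ⟨i, _, e, he, rfl⟩ := hz
      rw [single_mem_GrS, ← hu]
      exact Submodule.subset_span he) (by
      intro U hU hg
      apply GrS_le
      have main : ∀ n i, ∀ e ∈ C (i, n), Finsupp.single (i, n) e ∈ U := by
        intro n
        induction n with
        | zero =>
          intro i
          induction i using Nat.strong_induction_on with
          | _ i ih =>
            intro e he
            by_cases hi : i < i1 + 2
            · rw [← hu] at he
              have : Submodule.span B (u i : Set E) ≤ U.comap (Finsupp.lsingle (i, 0)) := by
                rw [Submodule.span_le]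
                intro y hy
                apply hg
                simp only [Finset.mem_biUnion, Finset.mem_image]
                exact ⟨i, Finset.mem_range.2 hi, y, hy, rfl⟩
              exact this he
            · obtain ⟨k, rfl⟩ : ∃ k, i = k + 2 := ⟨i - 2, by omega⟩
              refine hT (k, 0) (by simp; omega) e he (U.comap (Finsupp.lsingle (k + 2, 0))) ?_
              intro j z hz
              have := hU _ (Or.inl ⟨j, rfl⟩) _ (ih k (by omega) z hz)
              rw [opS_single] at this
              exact this
        | succ n ih =>
          intro i e he
          refine hX (i, n) e he (U.comap (Finsupp.lsingle (i, n + 1))) ?_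
          intro j z hz
          have := hU _ (Or.inr ⟨j, rfl⟩) _ (ih i z hz)
          rw [opS_single] at this
          exact this
      rintro ⟨i, n⟩
      exact main n i)
  refine ⟨fun K hK hKC hKt hKx => ?_, fun K hKt hKx A _ φ => ?_⟩
  · obtain ⟨m0, h0⟩ := key.1 ⟨fun m => GrS (K m), fun m n hmn w hw q => hK hmn q (hw q)⟩
      (fun m => hstab _ (hKt m) (hKx m)) (fun m w hw q => hKC m q (hw q))
    refine ⟨m0, fun m hm => ?_⟩
    funext q
    have := h0 m hm
    ext e
    rw [← single_mem_GrS, ← single_mem_GrS (K m0)]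
    exact Iff.of_eq (congrArg (fun V => Finsupp.single q e ∈ V) this)
  · refine (key.2 (GrS K) (hstab _ hKt hKx) A φ).subset ?_
    intro p hp
    obtain ⟨q, hp, z, hz, h⟩ := Set.mem_iUnion.1 hp
    refine ⟨hp, Finsupp.single q z, (single_mem_GrS _ _ _).2 hz, fun a => ?_⟩
    rw [Finsupp.smul_single, single_mem_GrS, h]

theorem AssZ_mono {A B : Type} [CommRing A] [CommRing B] (φ : A →+* B) {E : Type} [AddCommGroup E]
    [Module B E] (Z W Z' W' : Submodule B E) {κ : Type} [Finite κ] (u : κ → E →ₗ[B] E)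
    (h1 : ∀ j, ∀ z ∈ Z, u j z ∈ Z') (h2 : ∀ z ∈ Z, z ∈ W ↔ ∀ j, u j z ∈ W') :
    AssZ φ Z W ⊆ AssZ φ Z' W' := by
  rintro p ⟨hp, z, hz, h⟩
  cases nonempty_fintype κ
  let I : κ → Ideal A := fun j =>
    { carrier := {a | φ a • u j z ∈ W'}
      add_mem' := fun {a b} ha hb => by
        simp only [Set.mem_setOf_eq, map_add, add_smul] at *
        exact add_mem ha hb
      zero_mem' := by simp
      smul_mem' := fun c a ha => by
        simp only [Set.mem_setOf_eq, smul_eq_mul, map_mul, mul_smul] at *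
        exact Submodule.smul_mem _ _ ha }
  have hI : ∀ j a, a ∈ I j ↔ φ a • u j z ∈ W' := fun _ _ => Iff.rfl
  have hpI : ∀ a, a ∈ p ↔ ∀ j, a ∈ I j := by
    intro a
    rw [h, h2 _ (Submodule.smul_mem _ _ hz)]
    simp only [hI, map_smul]
  have hle : Finset.univ.inf I ≤ p := by
    intro a ha
    rw [hpI]
    intro j
    exact (Finset.inf_le (Finset.mem_univ j) : Finset.univ.inf I ≤ I j) ha
  obtain ⟨j, _, hj⟩ := (Ideal.IsPrime.inf_le' hp).1 hle
  refine ⟨hp, u j z, h1 j z hz, fun a => ?_⟩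
  rw [← hI]
  exact ⟨fun ha => (hpI a).1 ha j, fun ha => hj ha⟩

theorem stab_aux {α : Type} (F : ℕ → ℕ → Set α) (U : Set α) (hU : U.Finite) (hF : ∀ i n, F i n ⊆ U)
    (m0 : ℕ) (h1 : ∀ i n, m0 ≤ n → F i n ⊆ F i (n + 1)) (h2 : ∀ i n, m0 ≤ i → F i n ⊆ F (i + 1) n) :
    ∃ k, ∀ i n, k ≤ i → k ≤ n → F i n = F k k := by
  have h1' : ∀ i n n', m0 ≤ n → n ≤ n' → F i n ⊆ F i n' := by
    intro i n n' hn h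
    induction n', h using Nat.le_induction with
    | base => exact subset_rfl
    | succ k hk ih => exact ih.trans (h1 i k (by omega))
  have h2' : ∀ i i' n, m0 ≤ i → i ≤ i' → F i n ⊆ F i' n := by
    intro i i' n hn h
    induction i', h using Nat.le_induction with
    | base => exact subset_rfl
    | succ k hk ih => exact ih.trans (h2 k n (by omega))
  have h3 : ∀ i i' n n', m0 ≤ i → i ≤ i' → m0 ≤ n → n ≤ n' → F i n ⊆ F i' n' :=
    fun i i' n n' a b c d => (h2' i i' n a b).trans (h1' i' n n' c d)
  have hfin : ∀ i n, (F i n).Finite := fun i n => hU.subset (hF i n)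
  -- maximal cardinality
  obtain ⟨k, hk, hmax⟩ : ∃ k, m0 ≤ k ∧ ∀ k', k ≤ k' → (F k' k').ncard ≤ (F k k).ncard := by
    by_contra hcon
    push Not at hcon
    have : ∀ N, ∃ k, m0 ≤ k ∧ N ≤ (F k k).ncard := by
      intro N
      induction N with
      | zero => exact ⟨m0, le_rfl, Nat.zero_le _⟩
      | succ N ih =>
        obtain ⟨k, hk, hN⟩ := ih
        obtain ⟨k', hk', hlt⟩ := hcon k hk
        exact ⟨k', hk.trans hk', by omega⟩
    obtain ⟨k, _, hk⟩ := this (U.ncard + 1)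
    have := Set.ncard_le_ncard (hF k k) hU
    omega
  refine ⟨k, fun i n hi hn => ?_⟩
  have e1 : F k k ⊆ F i n := h3 _ _ _ _ hk hi hk hn
  have e2 : F i n ⊆ F (max i n) (max i n) := h3 _ _ _ _ (by omega) (by omega) (by omega) (by omega)
  have e3 := Set.eq_of_subset_of_ncard_le (e1.trans e2) (hmax (max i n) (by omega)) (hfin _ _)
  exact (e1.antisymm (e3 ▸ e2)).symm

/-- boundaries -/
def BdS {B E : Type} [CommRing B] [AddCommGroup E] [Module B E] (d : E →ₗ[B] E)
    (C : ℕ × ℕ → Submodule B E) (q : ℕ × ℕ) : Submodule B E :=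
  if q.1 = 0 then ⊥ else (C (q.1 - 1, q.2)).map d

theorem BdS_zero {B E : Type} [CommRing B] [AddCommGroup E] [Module B E] (d : E →ₗ[B] E)
    (C : ℕ × ℕ → Submodule B E) (n : ℕ) : BdS d C (0, n) = ⊥ := rfl

theorem BdS_succ {B E : Type} [CommRing B] [AddCommGroup E] [Module B E] (d : E →ₗ[B] E)
    (C : ℕ × ℕ → Submodule B E) (i n : ℕ) : BdS d C (i + 1, n) = (C (i, n)).map d := rfl

theorem bigraded_main {B E : Type} [CommRing B] [IsNoetherianRing B] [AddCommGroup E] [Module B E]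
    {κ ι : Type} [Finite κ] [Finite ι] (d : E →ₗ[B] E) (t : κ → E →ₗ[B] E) (x : ι → B)
    (C : ℕ × ℕ → Submodule B E) (dd : ∀ e, d (d e) = 0) (td : ∀ j e, t j (d e) = d (t j e))
    (tt : ∀ i j e, t i (t j e) = t j (t i e))
    (hCd : ∀ q, ∀ e ∈ C q, d e ∈ C (q + (1, 0)))
    (hCt : ∀ j q, ∀ e ∈ C q, t j e ∈ C (q + (2, 0))) (hCx : ∀ j q, ∀ e ∈ C q, x j • e ∈ C (q + (0, 1)))
    (hfg : ∀ q, (C q).FG) (i1 : ℕ)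
    (hX : ∀ q, ∀ e ∈ C (q + (0, 1)), ∀ U : Submodule B E,
      (∀ j, ∀ z ∈ C q, x j • z ∈ U) → e ∈ U)
    (hT : ∀ q : ℕ × ℕ, i1 ≤ q.1 → ∀ e ∈ C (q + (2, 0)), ∀ U : Submodule B E,
      (∀ j, ∀ z ∈ C q, t j z ∈ U) → e ∈ U)
    (A : Type) [CommRing A] (φ : A →+* B) :
    (⋃ q, AssZ φ (C q ⊓ LinearMap.ker d) (BdS d C q)).Finite ∧
    ∃ k, ∀ i ≥ k, ∀ n ≥ k,
      AssZ φ (C (2 * i, n) ⊓ LinearMap.ker d) (BdS d C (2 * i, n)) =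
        AssZ φ (C (2 * k, k) ⊓ LinearMap.ker d) (BdS d C (2 * k, k)) ∧
      AssZ φ (C (2 * i + 1, n) ⊓ LinearMap.ker d) (BdS d C (2 * i + 1, n)) =
        AssZ φ (C (2 * k + 1, k) ⊓ LinearMap.ker d) (BdS d C (2 * k + 1, k)) := by
  obtain ⟨H1, H2⟩ := bigraded_noeth t x C tt hCt hCx hfg i1 hX hT
  set Bd := BdS d C with hBd
  have hBC : ∀ q, Bd q ≤ C q := by
    rintro ⟨i | i, n⟩
    · rw [hBd, BdS_zero]; exact bot_le
    · rw [hBd, BdS_succ, Submodule.map_le_iff_le_comap]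
      exact fun e he => hCd (i, n) e he
  have hBk : ∀ q, ∀ e ∈ Bd q, d e = 0 := by
    rintro ⟨i | i, n⟩ e he
    · rw [hBd, BdS_zero, Submodule.mem_bot] at he; rw [he, map_zero]
    · obtain ⟨y, _, rfl⟩ := he; exact dd y
  have hBt : ∀ j q, ∀ e ∈ Bd q, t j e ∈ Bd (q + (2, 0)) := by
    rintro j ⟨i | i, n⟩ e he
    · rw [hBd, BdS_zero, Submodule.mem_bot] at he; rw [he, map_zero]; exact zero_mem _
    · obtain ⟨y, hy, rfl⟩ := he
      exact ⟨t j y, hCt j (i, n) y hy, (td j y).symm⟩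
  have hBx : ∀ j q, ∀ e ∈ Bd q, x j • e ∈ Bd (q + (0, 1)) := by
    rintro j ⟨i | i, n⟩ e he
    · rw [hBd, BdS_zero, Submodule.mem_bot] at he; rw [he, smul_zero]; exact zero_mem _
    · obtain ⟨y, hy, rfl⟩ := he
      exact ⟨x j • y, hCx j (i, n) y hy, by rw [map_smul]⟩
  have hfin := H2 Bd hBt hBx A φ
  have hfin' : (⋃ q, AssZ φ (C q ⊓ LinearMap.ker d) (Bd q)).Finite := by
    refine hfin.subset (Set.iUnion_mono fun q => ?_)
    rintro p ⟨hp, z, hz, h⟩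
    exact ⟨hp, z, hz.1, h⟩
  -- injectivity in the n direction
  obtain ⟨m1, hm1⟩ : ∃ m1, ∀ q : ℕ × ℕ, m1 < q.2 → ∀ z ∈ C q, d z = 0 →
      (∀ j, x j • z ∈ Bd (q + (0, 1))) → z ∈ Bd q := by
    let L : ℕ × ℕ → Submodule B E := fun q => C q ⊓ LinearMap.ker d ⊓
      ⨅ j, (Bd (q + (0, 1))).comap (x j • LinearMap.id)
    have hL : ∀ q z, z ∈ L q ↔ (z ∈ C q ∧ d z = 0) ∧ ∀ j, x j • z ∈ Bd (q + (0, 1)) := by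
      intro q z
      simp [L, Submodule.mem_iInf]
    have hBL : ∀ q, ∀ z ∈ Bd q, z ∈ L q := fun q z hz =>
      (hL q z).2 ⟨⟨hBC q hz, hBk q z hz⟩, fun j => hBx j q z hz⟩
    let K : ℕ → ℕ × ℕ → Submodule B E := fun m q => if m < q.2 then Bd q else L q
    have hBK : ∀ m q, ∀ z ∈ Bd q, z ∈ K m q := by
      intro m q z hz
      simp only [K]; split_ifs
      · exact hz
      · exact hBL q z hz
    have hKL : ∀ m q, ∀ z ∈ K m q, z ∈ L q := by
      intro m q z hz
      simp only [K] at hz; split_ifs at hz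
      · exact hBL q z hz
      · exact hz
    suffices h : ∃ m0, ∀ m ≥ m0, K m = K m0 by
      obtain ⟨m0, h0⟩ := h
      refine ⟨m0, fun q hq z hz hdz hxz => ?_⟩
      have h1 : z ∈ K q.2 q := by
        simp only [K, lt_irrefl, if_false]
        exact (hL q z).2 ⟨⟨hz, hdz⟩, hxz⟩
      rw [h0 q.2 hq.le] at h1
      simpa only [K, hq, if_true] using h1
    refine H1 K ?_ ?_ ?_ ?_
    · intro m m' hmm q z hz
      by_cases h : m' < q.2
      · have h' : m < q.2 := lt_of_le_of_lt hmm h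
        simp only [K, h', if_true] at hz
        exact hBK _ _ _ hz
      · simp only [K, h, if_false]
        exact hKL _ _ _ hz
    · exact fun m q z hz => ((hL q z).1 (hKL m q z hz)).1.1
    · intro m j q z hz
      by_cases h : m < q.2
      · simp only [K, h, if_true] at hz
        exact hBK _ _ _ (hBt j q z hz)
      · have h' : ¬ m < (q + (2, 0)).2 := h
        simp only [K, h', if_false]
        have h2 := (hL q z).1 (hKL m q z hz)
        refine (hL _ _).2 ⟨⟨hCt j q z h2.1.1, by rw [← td, h2.1.2, map_zero]⟩, fun k => ?_⟩
        have h3 := hBt j _ _ (h2.2 k)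
        rw [map_smul, add_right_comm] at h3
        exact h3
    · intro m j q z hz
      exact hBK _ _ _ (((hL q z).1 (hKL m q z hz)).2 j)
  obtain ⟨m2, hm2⟩ : ∃ m2, ∀ q : ℕ × ℕ, m2 < q.1 → ∀ z ∈ C q, d z = 0 →
      (∀ j, t j z ∈ Bd (q + (2, 0))) → z ∈ Bd q := by
    let L : ℕ × ℕ → Submodule B E := fun q => C q ⊓ LinearMap.ker d ⊓
      ⨅ j, (Bd (q + (2, 0))).comap (t j)
    have hL : ∀ q z, z ∈ L q ↔ (z ∈ C q ∧ d z = 0) ∧ ∀ j, t j z ∈ Bd (q + (2, 0)) := by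
      intro q z
      simp [L, Submodule.mem_iInf]
    have hBL : ∀ q, ∀ z ∈ Bd q, z ∈ L q := fun q z hz =>
      (hL q z).2 ⟨⟨hBC q hz, hBk q z hz⟩, fun j => hBt j q z hz⟩
    let K : ℕ → ℕ × ℕ → Submodule B E := fun m q => if m < q.1 then Bd q else L q
    have hBK : ∀ m q, ∀ z ∈ Bd q, z ∈ K m q := by
      intro m q z hz
      simp only [K]; split_ifs
      · exact hz
      · exact hBL q z hz
    have hKL : ∀ m q, ∀ z ∈ K m q, z ∈ L q := by
      intro m q z hz
      simp only [K] at hz; split_ifs at hz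
      · exact hBL q z hz
      · exact hz
    suffices h : ∃ m0, ∀ m ≥ m0, K m = K m0 by
      obtain ⟨m0, h0⟩ := h
      refine ⟨m0, fun q hq z hz hdz hxz => ?_⟩
      have h1 : z ∈ K q.1 q := by
        simp only [K, lt_irrefl, if_false]
        exact (hL q z).2 ⟨⟨hz, hdz⟩, hxz⟩
      rw [h0 q.1 hq.le] at h1
      simpa only [K, hq, if_true] using h1
    refine H1 K ?_ ?_ ?_ ?_
    · intro m m' hmm q z hz
      by_cases h : m' < q.1
      · have h' : m < q.1 := lt_of_le_of_lt hmm h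
        simp only [K, h', if_true] at hz
        exact hBK _ _ _ hz
      · simp only [K, h, if_false]
        exact hKL _ _ _ hz
    · exact fun m q z hz => ((hL q z).1 (hKL m q z hz)).1.1
    · intro m j q z hz
      exact hBK _ _ _ (((hL q z).1 (hKL m q z hz)).2 j)
    · intro m j q z hz
      by_cases h : m < q.1
      · simp only [K, h, if_true] at hz
        exact hBK _ _ _ (hBx j q z hz)
      · have h' : ¬ m < (q + (0, 1)).1 := h
        simp only [K, h', if_false]
        have h2 := (hL q z).1 (hKL m q z hz)
        refine (hL _ _).2 ⟨⟨hCx j q z h2.1.1, by rw [map_smul, h2.1.2, smul_zero]⟩, fun k => ?_⟩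
        have h3 := hBx j _ _ (h2.2 k)
        rw [← map_smul, add_right_comm] at h3
        exact h3
  have monoX : ∀ q : ℕ × ℕ, m1 < q.2 → AssZ φ (C q ⊓ LinearMap.ker d) (Bd q) ⊆
      AssZ φ (C (q + (0, 1)) ⊓ LinearMap.ker d) (Bd (q + (0, 1))) := by
    intro q hq
    refine AssZ_mono φ _ _ _ _ (fun j => x j • LinearMap.id) ?_ ?_
    · rintro j z ⟨h1, h2⟩
      refine ⟨hCx j q z h1, ?_⟩
      change d (x j • z) = 0
      rw [map_smul, show d z = 0 from h2, smul_zero]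
    · rintro z ⟨h1, h2⟩
      exact ⟨fun h j => hBx j q z h, fun h => hm1 q hq z h1 h2 h⟩
  have monoT : ∀ q : ℕ × ℕ, m2 < q.1 → AssZ φ (C q ⊓ LinearMap.ker d) (Bd q) ⊆
      AssZ φ (C (q + (2, 0)) ⊓ LinearMap.ker d) (Bd (q + (2, 0))) := by
    intro q hq
    refine AssZ_mono φ _ _ _ _ t ?_ ?_
    · rintro j z ⟨h1, h2⟩
      refine ⟨hCt j q z h1, ?_⟩
      change d (t j z) = 0
      rw [← td, show d z = 0 from h2, map_zero]
    · rintro z ⟨h1, h2⟩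
      exact ⟨fun h j => hBt j q z h, fun h => hm2 q hq z h1 h2 h⟩
  refine ⟨hfin', ?_⟩
  have hst : ∀ r : ℕ, ∃ k, ∀ i n, k ≤ i → k ≤ n →
      AssZ φ (C (2 * i + r, n) ⊓ LinearMap.ker d) (Bd (2 * i + r, n)) =
        AssZ φ (C (2 * k + r, k) ⊓ LinearMap.ker d) (Bd (2 * k + r, k)) := by
    intro r
    refine stab_aux (fun i n => AssZ φ (C (2 * i + r, n) ⊓ LinearMap.ker d) (Bd (2 * i + r, n)))
      _ hfin' (fun i n => Set.subset_iUnion (fun q => AssZ φ (C q ⊓ LinearMap.ker d) (Bd q)) (2 * i + r, n))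
      (m1 + m2 + 1) ?_ ?_
    · intro i n hn
      exact monoX (2 * i + r, n) (by simp; omega)
    · intro i n hi
      have := monoT (2 * i + r, n) (by simp; omega)
      have e : ((2 * i + r, n) : ℕ × ℕ) + (2, 0) = (2 * (i + 1) + r, n) := by
        ext <;> simp; omega
      rw [e] at this
      exact this
  obtain ⟨k0, h0⟩ := hst 0
  obtain ⟨k1, h1⟩ := hst 1
  refine ⟨max k0 k1, fun i hi n hn => ⟨?_, ?_⟩⟩
  · exact (h0 i n (by omega) (by omega)).trans (h0 (max k0 k1) (max k0 k1) (by omega) (by omega)).symm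
  · exact (h1 i n (by omega) (by omega)).trans (h1 (max k0 k1) (max k0 k1) (by omega) (by omega)).symm

/-- homology of a pair of maps -/
abbrev Hm {R : Type} [CommRing R] {C0 C1 C2 : Type} [AddCommGroup C0] [AddCommGroup C1]
    [AddCommGroup C2] [Module R C0] [Module R C1] [Module R C2] (α : C0 →ₗ[R] C1)
    (β : C1 →ₗ[R] C2) : Type :=
  ↥(LinearMap.ker β) ⧸ (LinearMap.range α).comap (LinearMap.ker β).subtype

theorem Hm_congr {R : Type} [CommRing R] {C0 C1 C2 : Type} [AddCommGroup C0] [AddCommGroup C1]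
    [AddCommGroup C2] [Module R C0] [Module R C1] [Module R C2] (α : C0 →ₗ[R] C1)
    (β : C1 →ₗ[R] C2) {C0' C1' C2' : Type} [AddCommGroup C0'] [AddCommGroup C1']
    [AddCommGroup C2'] [Module R C0'] [Module R C1'] [Module R C2'] (α' : C0' →ₗ[R] C1')
    (β' : C1' →ₗ[R] C2') (e0 : C0 ≃ₗ[R] C0') (e1 : C1 ≃ₗ[R] C1') (e2 : C2 ≃ₗ[R] C2')
    (h1 : ∀ x, e1 (α x) = α' (e0 x)) (h2 : ∀ x, e2 (β x) = β' (e1 x)) :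
    Nonempty (Hm α β ≃ₗ[R] Hm α' β') := by
  have hk : (LinearMap.ker β).map (e1 : C1 →ₗ[R] C1') = LinearMap.ker β' := by
    ext y
    rw [Submodule.mem_map]
    constructor
    · rintro ⟨x, hx, rfl⟩
      change β' (e1 x) = 0
      rw [← h2, show β x = 0 from hx, map_zero]
    · intro hy
      refine ⟨e1.symm y, ?_, by simp⟩
      change β _ = 0
      apply e2.injective
      rw [h2, e1.apply_symm_apply, show β' y = 0 from hy, map_zero]
  refine ⟨Submodule.Quotient.equiv _ _ (e1.submoduleMap _ |>.trans (LinearEquiv.ofEq _ _ hk)) ?_⟩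
  ext ⟨y, hy⟩
  simp only [Submodule.mem_map, Submodule.mem_comap]
  constructor
  · rintro ⟨x, ⟨z, hz⟩, hx⟩
    refine ⟨e0 z, ?_⟩
    rw [← h1, hz]
    exact congrArg Subtype.val hx
  · rintro ⟨z, hz⟩
    refine ⟨⟨e1.symm y, ?_⟩, ⟨e0.symm z, ?_⟩, ?_⟩
    · rw [← hk] at hy
      obtain ⟨x, hx, rfl⟩ := hy
      simpa using hx
    · apply e1.injective
      rw [h1]
      simpa using hz
    · apply Subtype.ext
      change e1 (e1.symm y) = y
      simp

/-- projective resolutions -/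
structure Res (R : Type) [CommRing R] (M : Type) [AddCommGroup M] [Module R M] (X : ℕ → Type)
    [∀ n, AddCommGroup (X n)] [∀ n, Module R (X n)] where
  d : ∀ n, X (n + 1) →ₗ[R] X n
  ε : X 0 →ₗ[R] M
  proj : ∀ n, Module.Projective R (X n)
  surj : Function.Surjective ε
  exact0 : Function.Exact (d 0) ε
  exact : ∀ n, Function.Exact (d (n + 1)) (d n)

section
variable {R : Type} [CommRing R] {M : Type} [AddCommGroup M] [Module R M] {X : ℕ → Type}
    [∀ n, AddCommGroup (X n)] [∀ n, Module R (X n)]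

/-- incoming map -/
def Res.inc (S : Res R M X) (N : Type) [AddCommGroup N] [Module R N] :
    ∀ i : ℕ, (X (i - 1) →ₗ[R] N) →ₗ[R] (X i →ₗ[R] N)
  | 0 => 0
  | i + 1 => LinearMap.lcomp R N (S.d i)

/-- the complex -/
noncomputable def Res.cx (S : Res R M X) : ChainComplex (ModuleCat R) ℕ :=
  ChainComplex.of (fun n => ModuleCat.of R (X n)) (fun n => ModuleCat.ofHom (S.d n)) (by
    intro n
    ext x
    exact (S.exact n).apply_apply_eq_zero x)

theorem Res.cx_d (S : Res R M X) (n : ℕ) : S.cx.d (n + 1) n = ModuleCat.ofHom (S.d n) :=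
  ChainComplex.of_d (fun n => ModuleCat.of R (X n)) (fun n => ModuleCat.ofHom (S.d n)) n

/-- the resolution -/
noncomputable def Res.pr (S : Res R M X) : ProjectiveResolution (ModuleCat.of R M) where
  complex := S.cx
  projective n := by
    haveI := S.proj n
    exact (IsProjective.iff_projective (X n)).1 (S.proj n)
  π := (ChainComplex.toSingle₀Equiv _ _).symm ⟨ModuleCat.ofHom S.ε, by
    rw [S.cx_d]
    ext x
    exact S.exact0.apply_apply_eq_zero x⟩
  quasiIso := ⟨fun n => by
    cases n with
    | zero =>
      rw [ChainComplex.quasiIsoAt₀_iff, ShortComplex.quasiIso_iff_of_zeros']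
      · refine (ShortComplex.exact_and_epi_g_iff_of_iso
          (S₂ := ShortComplex.moduleCatMk (S.d 0) S.ε S.exact0.linearMap_comp_eq_zero) ?_).2
          ⟨?_, ?_⟩
        · refine ShortComplex.isoMk (Iso.refl _) (Iso.refl _) (Iso.refl _) ?_ ?_
          · ext x
            change S.d 0 x = S.cx.d 1 0 x
            rw [S.cx_d]
            rfl
          · ext x
            change S.ε x = _
            simp
            rfl
        · rw [ShortComplex.moduleCat_exact_iff]
          intro x hx
          exact (S.exact0 x).1 hx
        · rw [ModuleCat.epi_iff_surjective]
          exact S.surj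
      all_goals rfl
    | succ n =>
      rw [quasiIsoAt_iff_exactAt']
      · rw [HomologicalComplex.exactAt_iff' _ (n + 1 + 1) (n + 1) n (by simp) (by simp)]
        rw [ShortComplex.moduleCat_exact_iff]
        intro x hx
        change S.cx.d (n + 1) n x = 0 at hx
        rw [S.cx_d] at hx
        obtain ⟨y, hy⟩ := (S.exact n x).1 hx
        refine ⟨y, ?_⟩
        change S.cx.d (n + 1 + 1) (n + 1) y = x
        rw [S.cx_d]
        exact hy
      · apply ChainComplex.exactAt_succ_single_obj⟩

theorem Res.ext_equiv (S : Res R M X) (N : Type) [AddCommGroup N] [Module R N] (i : ℕ) :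
    Nonempty (extAP R M N i ≃ₗ[R] Hm (S.inc N i) (LinearMap.lcomp R N (S.d i))) := by
  let K := S.cx.linearYonedaObj R (ModuleCat.of R N)
  let T := K.sc' (i - 1) i (i + 1)
  let e1 : extAP R M N i ≃ₗ[R] K.homology i :=
    (S.pr.isoExt (R := R) i (ModuleCat.of R N)).toLinearEquiv
  let e2 : K.homology i ≃ₗ[R] T.homology :=
    (ShortComplex.homologyMapIso
      (K.isoSc' (i - 1) i (i + 1) (by cases i <;> simp) (by simp))).toLinearEquiv
  let e3 : T.homology ≃ₗ[R] (LinearMap.ker T.g.hom ⧸ LinearMap.range T.moduleCatToCycles) :=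
    T.moduleCatHomologyIso.toLinearEquiv
  have h4 : LinearMap.range T.moduleCatToCycles =
      (LinearMap.range T.f.hom).comap (LinearMap.ker T.g.hom).subtype := by
    ext ⟨x, hx⟩
    simp only [LinearMap.mem_range, Submodule.mem_comap]
    constructor
    · rintro ⟨y, hy⟩
      exact ⟨y, congrArg Subtype.val hy⟩
    · rintro ⟨y, hy⟩
      exact ⟨y, Subtype.ext hy⟩
  let e4 : (LinearMap.ker T.g.hom ⧸ LinearMap.range T.moduleCatToCycles) ≃ₗ[R]
      Hm T.f.hom T.g.hom := Submodule.quotEquivOfEq _ _ h4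
  let q : ∀ j, K.X j ≃ₗ[R] (X j →ₗ[R] N) := fun j =>
    ModuleCat.homLinearEquiv (S := R) (M := ModuleCat.of R (X j)) (N := ModuleCat.of R N)
  have hd : ∀ j (x : K.X j), q (j + 1) (K.d j (j + 1) x) = (q j x).comp (S.d j) := by
    intro j x
    ext y
    have : K.d j (j + 1) x = S.cx.d (j + 1) j ≫ (x : S.cx.X j ⟶ ModuleCat.of R N) := rfl
    rw [this, S.cx_d]
    rfl
  have h1 : ∀ x, q i (T.f.hom x) = S.inc N i (q (i - 1) x) := by
    intro x
    cases i with
    | zero =>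
      have : K.d 0 0 = 0 := K.shape _ _ (by simp)
      change q 0 ((K.d 0 0).hom x) = 0
      rw [this]
      exact map_zero (q 0)
    | succ i => exact hd i x
  obtain ⟨e5⟩ := Hm_congr T.f.hom T.g.hom (S.inc N i) (LinearMap.lcomp R N (S.d i))
    (q (i - 1)) (q i) (q (i + 1)) h1 (fun x => hd i x)
  exact ⟨e1.trans (e2.trans (e3.trans (e4.trans e5)))⟩
end

open scoped TensorProduct

/-- primes which are annihilators after base change -/
def AssH {A B : Type} [CommRing A] [CommRing B] (φ : A →+* B) (H : Type) [AddCommGroup H]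
    [Module B H] : Set (Ideal A) :=
  {p | p.IsPrime ∧ ∃ h : H, ∀ a, a ∈ p ↔ φ a • h = 0}

theorem AssH_congr {A B : Type} [CommRing A] [CommRing B] (φ : A →+* B) (H H' : Type)
    [AddCommGroup H] [Module B H] [AddCommGroup H'] [Module B H'] (e : H ≃ₗ[B] H') :
    AssH φ H = AssH φ H' := by
  ext p
  constructor
  · rintro ⟨hp, h, hh⟩
    refine ⟨hp, e h, fun a => ?_⟩
    rw [hh, ← map_smul, e.map_eq_zero_iff]
  · rintro ⟨hp, h, hh⟩
    refine ⟨hp, e.symm h, fun a => ?_⟩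
    rw [hh, ← map_smul, e.symm.map_eq_zero_iff]

theorem AssH_Hm {A B : Type} [CommRing A] [CommRing B] (φ : A →+* B)
    {C0 C1 C2 : Type} [AddCommGroup C0] [AddCommGroup C1]
    [AddCommGroup C2] [Module B C0] [Module B C1] [Module B C2] (α : C0 →ₗ[B] C1)
    (β : C1 →ₗ[B] C2) :
    AssH φ (Hm α β) = AssZ φ (LinearMap.ker β) (LinearMap.range α) := by
  have key : ∀ (z : LinearMap.ker β) (b : B),
      b • (Submodule.Quotient.mk z : Hm α β) = 0 ↔ b • (z : C1) ∈ LinearMap.range α := by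
    intro z b
    rw [← Submodule.Quotient.mk_smul, Submodule.Quotient.mk_eq_zero]
    rfl
  ext p
  constructor
  · rintro ⟨hp, h, hh⟩
    obtain ⟨z, rfl⟩ := Submodule.Quotient.mk_surjective _ h
    exact ⟨hp, z, z.2, fun a => (hh a).trans (key _ _)⟩
  · rintro ⟨hp, z, hz, hh⟩
    exact ⟨hp, Submodule.Quotient.mk ⟨z, hz⟩, fun a => (hh a).trans (key ⟨z, hz⟩ _).symm⟩

section
variable {A B : Type} [CommRing A] [CommRing B] [Algebra A B] [Module.Flat A B]

theorem AssH_tensor_Hm 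
    {C0 C1 C2 : Type} [AddCommGroup C0] [AddCommGroup C1]
    [AddCommGroup C2] [Module A C0] [Module A C1] [Module A C2] (α : C0 →ₗ[A] C1)
    (β : C1 →ₗ[A] C2) (hβα : ∀ x, β (α x) = 0)
    {C0' C1' C2' : Type} [AddCommGroup C0'] [AddCommGroup C1']
    [AddCommGroup C2'] [Module B C0'] [Module B C1'] [Module B C2'] (α' : C0' →ₗ[B] C1')
    (β' : C1' →ₗ[B] C2')
    (e0 : B ⊗[A] C0 ≃ₗ[B] C0') (e1 : B ⊗[A] C1 ≃ₗ[B] C1') (e2 : B ⊗[A] C2 ≃ₗ[B] C2')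
    (h1 : ∀ x, e1 (α.baseChange B x) = α' (e0 x))
    (h2 : ∀ x, e2 (β.baseChange B x) = β' (e1 x)) :
    AssH (algebraMap A B) (B ⊗[A] Hm α β) =
      AssZ (algebraMap A B) (LinearMap.ker β') (LinearMap.range α') := by
  let j : LinearMap.ker β →ₗ[A] C1 := (LinearMap.ker β).subtype
  let a0 : C0 →ₗ[A] LinearMap.ker β := α.codRestrict _ hβα
  let q : LinearMap.ker β →ₗ[A] Hm α β := Submodule.mkQ _
  have ex1 : Function.Exact a0 q := by
    intro y
    change (Submodule.Quotient.mk y : Hm α β) = 0 ↔ _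
    rw [Submodule.Quotient.mk_eq_zero]
    constructor
    · rintro ⟨x, hx⟩
      exact ⟨x, Subtype.ext hx⟩
    · rintro ⟨x, rfl⟩
      exact ⟨x, rfl⟩
  have hq : Function.Surjective q := Submodule.mkQ_surjective _
  have ex1' : Function.Exact (a0.baseChange B) (q.baseChange B) := lTensor_exact B ex1 hq
  have hq' : Function.Surjective (q.baseChange B) := LinearMap.lTensor_surjective B hq
  have ex2 : Function.Exact (j.baseChange B) (β.baseChange B) := by
    refine Module.Flat.lTensor_exact B (f := j) (g := β) ?_
    intro y
    constructor
    · intro hy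
      exact ⟨⟨y, hy⟩, rfl⟩
    · rintro ⟨x, rfl⟩
      exact x.2
  have hj : Function.Injective (j.baseChange B) :=
    Module.Flat.lTensor_preserves_injective_linearMap (M := B) j Subtype.val_injective
  have hja : ∀ x, j.baseChange B (a0.baseChange B x) = α.baseChange B x := by
    intro x
    have : (j ∘ₗ a0) = α := rfl
    rw [← this, LinearMap.baseChange_comp]
    rfl
  have key : ∀ (u : B ⊗[A] LinearMap.ker β) (b : B),
      b • q.baseChange B u = 0 ↔ b • e1 (j.baseChange B u) ∈ LinearMap.range α' := by
    intro u b
    rw [← map_smul, ← map_smul, ← map_smul]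
    constructor
    · intro h
      obtain ⟨v, hv⟩ := (ex1' _).1 h
      refine ⟨e0 v, ?_⟩
      rw [← h1, ← hja, hv]
    · rintro ⟨v, hv⟩
      refine (ex1' _).2 ⟨e0.symm v, hj (e1.injective ?_)⟩
      rw [hja, h1, e0.apply_symm_apply, hv]
  ext p
  constructor
  · rintro ⟨hp, h, hh⟩
    obtain ⟨u, rfl⟩ := hq' h
    refine ⟨hp, e1 (j.baseChange B u), ?_, fun a => (hh a).trans (key _ _)⟩
    rw [LinearMap.mem_ker, ← h2, ex2.apply_apply_eq_zero, map_zero]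
  · rintro ⟨hp, z, hz, hh⟩
    have : β.baseChange B (e1.symm z) = 0 := by
      apply e2.injective
      rw [h2, e1.apply_symm_apply, map_zero]
      exact hz
    obtain ⟨u, hu⟩ := (ex2 _).1 this
    refine ⟨hp, q.baseChange B u, fun a => (hh a).trans ?_⟩
    rw [key, hu, e1.apply_symm_apply]

theorem ass_eq_AssH [IsNoetherianRing A] (E : Type) [AddCommGroup E] [Module A E]
    (hinj : Function.Injective (TensorProduct.mk A B E 1)) :
    associatedPrimes A E = AssH (algebraMap A B) (B ⊗[A] E) := by
  classical
  ext p
  rw [AssociatedPrimes.mem_iff, isAssociatedPrime_iff]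
  constructor
  · rintro ⟨hp, x, hx⟩
    refine ⟨hp, 1 ⊗ₜ x, fun a => ?_⟩
    rw [hx, Submodule.mem_colon_singleton, Submodule.mem_bot, algebraMap_smul,
      ← TensorProduct.tmul_smul]
    rw [← (map_eq_zero_iff (TensorProduct.mk A B E 1) hinj)]
    rfl
  · rintro ⟨hp, z, hz⟩
    refine ⟨hp, ?_⟩
    by_contra hcon
    push Not at hcon
    obtain ⟨s, hs⟩ := (IsNoetherian.noetherian p : p.FG)
    let θ : E →ₗ[A] (s → E) := LinearMap.pi fun a => LinearMap.lsmul A E a.1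
    let T := LinearMap.ker θ
    have hT : ∀ t ∈ T, ∀ a ∈ p, a • t = 0 := by
      intro t ht a ha
      have : p ≤ LinearMap.ker (LinearMap.toSpanSingleton A E t) := by
        rw [← hs, Submodule.span_le]
        intro b hb
        exact congrFun (show θ t = 0 from ht) ⟨b, hb⟩
      exact this ha
    have ex : Function.Exact (T.subtype.lTensor B) (θ.lTensor B) := by
      refine Module.Flat.lTensor_exact B (f := T.subtype) (g := θ) ?_
      intro y
      constructor
      · intro hy
        exact ⟨⟨y, hy⟩, rfl⟩
      · rintro ⟨x, rfl⟩
        exact x.2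
    have hθ : θ.lTensor B z = 0 := by
      apply (TensorProduct.piRight A A B (fun _ : s => E)).injective
      rw [map_zero]
      funext a
      have h1 : ∀ w : B ⊗[A] E, TensorProduct.piRight A A B (fun _ : s => E) (θ.lTensor B w) a
          = a.1 • w := by
        intro w
        induction w with
        | zero => simp
        | add x y hx hy => rw [map_add, map_add, Pi.add_apply, hx, hy, smul_add]
        | tmul b e => simp [θ]
      rw [h1]
      have : a.1 ∈ p := by
        rw [← hs]
        exact Submodule.subset_span a.2
      have := (hz _).1 this
      rwa [algebraMap_smul] at this
    obtain ⟨w, rfl⟩ := (ex z).1 hθ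
    have hw : ∀ w : B ⊗[A] T, ∃ r : A, r ∉ p ∧ r • w = 0 := by
      intro w
      induction w with
      | zero => exact ⟨1, fun h => hp.ne_top ((Ideal.eq_top_iff_one _).2 h), smul_zero _⟩
      | add x y hx hy =>
        obtain ⟨r, hr, h1⟩ := hx
        obtain ⟨r', hr', h2⟩ := hy
        refine ⟨r * r', fun h => (hp.mem_or_mem h).elim hr hr', ?_⟩
        rw [smul_add, mul_comm, mul_smul, h1, mul_comm, mul_smul, h2]
        simp
      | tmul b t =>
        have h1 := hcon t.1
        have h2 : p ≤ Submodule.colon ⊥ {t.1} := by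
          intro a ha
          rw [Submodule.mem_colon_singleton]
          exact hT _ t.2 a ha
        obtain ⟨r, hr, hr'⟩ := SetLike.not_le_iff_exists.1 (fun h => h1 (le_antisymm h2 h))
        refine ⟨r, hr', ?_⟩
        rw [Submodule.mem_colon_singleton] at hr
        have : r • t = 0 := Subtype.ext hr
        rw [← TensorProduct.tmul_smul, this, TensorProduct.tmul_zero]
    obtain ⟨r, hr, hrw⟩ := hw w
    apply hr
    rw [hz, algebraMap_smul, ← map_smul, hrw, map_zero]

variable (A) in
/-- base change of a resolution -/
noncomputable def Res.bc {M : Type} [AddCommGroup M] [Module A M] {X : ℕ → Type}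
    [∀ n, AddCommGroup (X n)] [∀ n, Module A (X n)] (S : Res A M X) (B : Type) [CommRing B]
    [Algebra A B] [Module.Flat A B] :
    Res B (B ⊗[A] M) (fun n => B ⊗[A] X n) where
  d n := (S.d n).baseChange B
  ε := S.ε.baseChange B
  proj n := by
    haveI := S.proj n
    infer_instance
  surj := LinearMap.lTensor_surjective B S.surj
  exact0 := Module.Flat.lTensor_exact B S.exact0
  exact n := Module.Flat.lTensor_exact B (S.exact n)

theorem lcomp_bc {G G' N : Type} [AddCommGroup G] [Module A G] [AddCommGroup G'] [Module A G']
    [AddCommGroup N] [Module A N] [Module.FinitePresentation A G] [Module.FinitePresentation A G']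
    (f : G →ₗ[A] G') (x : B ⊗[A] (G' →ₗ[A] N)) :
    (Module.FinitePresentation.isBaseChange_map A G N B).equiv
      ((LinearMap.lcomp A N f).baseChange B x) =
    ((Module.FinitePresentation.isBaseChange_map A G' N B).equiv x).comp (f.baseChange B) := by
  induction x with
  | zero => simp
  | add x y hx hy => rw [map_add, map_add, map_add, hx, hy, LinearMap.add_comp]
  | tmul b φ =>
    rw [LinearMap.baseChange_tmul, IsBaseChange.equiv_tmul, IsBaseChange.equiv_tmul]
    ext g
    simp

/-- the set computed by a resolution -/
def Res.AssS {A B : Type} [CommRing A] [CommRing B] (φ : A →+* B)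
    {M : Type} [AddCommGroup M] [Module B M]
    {Y : ℕ → Type} [∀ n, AddCommGroup (Y n)] [∀ n, Module B (Y n)] (T : Res B M Y) (N : Type)
    [AddCommGroup N] [Module B N] (i : ℕ) : Set (Ideal A) :=
  AssZ φ (LinearMap.ker (LinearMap.lcomp B N (T.d i))) (LinearMap.range (T.inc N i))

theorem Res.AssS_eq {A B : Type} [CommRing A] [CommRing B] (φ : A →+* B)
    {M : Type} [AddCommGroup M] [Module B M]
    {Y : ℕ → Type} [∀ n, AddCommGroup (Y n)] [∀ n, Module B (Y n)] (T : Res B M Y)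
    {Y' : ℕ → Type} [∀ n, AddCommGroup (Y' n)] [∀ n, Module B (Y' n)] (T' : Res B M Y') (N : Type)
    [AddCommGroup N] [Module B N] (i : ℕ) : T.AssS φ N i = T'.AssS φ N i := by
  obtain ⟨e2⟩ := T.ext_equiv N i
  obtain ⟨e3⟩ := T'.ext_equiv N i
  refine (AssH_Hm φ (T.inc N i) (LinearMap.lcomp B N (T.d i))).symm.trans ?_
  refine Eq.trans ?_ (AssH_Hm φ (T'.inc N i) (LinearMap.lcomp B N (T'.d i)))
  exact AssH_congr φ _ _ (e2.symm.trans e3)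

theorem ass_ext1 [IsNoetherianRing A] {M : Type} [AddCommGroup M] [Module A M] {X : ℕ → Type}
    [∀ n, AddCommGroup (X n)] [∀ n, Module A (X n)] (S : Res A M X)
    (hX : ∀ n, Module.Finite A (X n)) (N : Type) [AddCommGroup N] [Module A N] 
    (N' : Type) [AddCommGroup N'] [Module B N'] (X' : ℕ → Type) [∀ n, AddCommGroup (X' n)]
    [∀ n, Module B (X' n)] (M' : Type) [AddCommGroup M'] [Module B M']
    (T : Res B M' X')
    (e : ∀ n, B ⊗[A] (X n →ₗ[A] N) ≃ₗ[B] (X' n →ₗ[B] N'))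
    (he : ∀ n x, e (n + 1) ((LinearMap.lcomp A N (S.d n)).baseChange B x) = (e n x).comp (T.d n)) (i : ℕ) :
    AssH (algebraMap A B) (B ⊗[A] Hm (S.inc N i) (LinearMap.lcomp A N (S.d i))) = T.AssS (algebraMap A B) N' i := by
  refine AssH_tensor_Hm (S.inc N i) (LinearMap.lcomp A N (S.d i)) ?_ 
    (T.inc N' i) (LinearMap.lcomp B N' (T.d i))
    (e (i - 1)) (e i) (e (i + 1)) ?_ ?_
  · intro x
    cases i with
    | zero => rfl
    | succ i =>
      ext y
      change x (S.d i (S.d (i + 1) y)) = 0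
      rw [(S.exact i).apply_apply_eq_zero, map_zero]
  · intro x
    cases i with
    | zero =>
      have h1 : S.inc N 0 = 0 := rfl
      have h2 : T.inc N' 0 = 0 := rfl
      rw [h1, h2, LinearMap.baseChange_zero, LinearMap.zero_apply, LinearMap.zero_apply, map_zero]
    | succ i => exact he _ _
  · intro x
    exact he _ _

theorem ass_ext [IsNoetherianRing A] {M : Type} [AddCommGroup M] [Module A M] {X : ℕ → Type}
    [∀ n, AddCommGroup (X n)] [∀ n, Module A (X n)] (S : Res A M X)
    (hX : ∀ n, Module.Finite A (X n)) (N : Type) [AddCommGroup N] [Module A N]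
    (hinj : ∀ (E : Type) [AddCommGroup E] [Module A E],
      Function.Injective (TensorProduct.mk A B E 1)) 
    {Y : ℕ → Type} [∀ n, AddCommGroup (Y n)] [∀ n, Module B (Y n)] (T : Res B (B ⊗[A] M) Y)
    (i : ℕ) :
    associatedPrimes A (extAP A M N i) = T.AssS (algebraMap A B) (B ⊗[A] N) i := by
  obtain ⟨e1⟩ := S.ext_equiv N i
  rw [LinearEquiv.AssociatedPrimes.eq e1, ass_eq_AssH (B := B) _ (hinj _)]
  rw [← (S.bc A B).AssS_eq (algebraMap A B) T]
  haveI : ∀ n, Module.FinitePresentation A (X n) := fun n =>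
    haveI := hX n
    Module.finitePresentation_of_finite A (X n)
  apply ass_ext1 S hX N (B ⊗[A] N) _ _ (S.bc A B) (fun n => (Module.FinitePresentation.isBaseChange_map A (X n) N B).equiv)
  intro n x
  exact lcomp_bc _ _
end

/-- finitely generated modules -/
structure FGM (A : Type) [CommRing A] where
  C : Type
  [grp : AddCommGroup C]
  [mod : Module A C]
  [fin : Module.Finite A C]

attribute [instance] FGM.grp FGM.mod FGM.fin

section
variable {A : Type} [CommRing A] [IsNoetherianRing A]

/-- number of generators -/
noncomputable def FGM.k (M : FGM A) : ℕ := (Module.Finite.exists_fin' A M.C).choose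

/-- cover -/
noncomputable def FGM.f (M : FGM A) : (Fin M.k → A) →ₗ[A] M.C :=
  (Module.Finite.exists_fin' A M.C).choose_spec.choose

theorem FGM.f_surj (M : FGM A) : Function.Surjective M.f :=
  (Module.Finite.exists_fin' A M.C).choose_spec.choose_spec

/-- syzygy -/
noncomputable def FGM.syz (M : FGM A) : FGM A := ⟨LinearMap.ker M.f⟩

/-- all syzygies -/
noncomputable def FGM.seq (M : FGM A) : ℕ → FGM A
  | 0 => M
  | n + 1 => (FGM.seq M n).syz

theorem exists_res (M : FGM A) :
    ∃ k : ℕ → ℕ, Nonempty (Res A M.C (fun n => Fin (k n) → A)) := by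
  refine ⟨fun n => (M.seq n).k, ⟨?_⟩⟩
  have hd : ∀ (n : ℕ) x y, ((LinearMap.ker (M.seq n).f).subtype ∘ₗ (M.seq (n + 1)).f) x = y ↔
    ((M.seq (n + 1)).f x).1 = y := fun n x y => Iff.rfl
  refine
  { d := fun n => (LinearMap.ker (M.seq n).f).subtype ∘ₗ (M.seq (n + 1)).f
    ε := M.f
    proj := fun n => inferInstance
    surj := M.f_surj
    exact0 := ?_
    exact := ?_ }
  · intro y
    constructor
    · intro hy
      obtain ⟨x, hx⟩ := (M.seq 1).f_surj ⟨y, hy⟩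
      exact ⟨x, congrArg Subtype.val hx⟩
    · rintro ⟨x, rfl⟩
      exact ((M.seq 1).f x).2
  · intro n y
    constructor
    · intro hy
      have hy' : (M.seq (n + 1)).f y = 0 := Subtype.ext hy
      obtain ⟨x, hx⟩ := (M.seq (n + 1 + 1)).f_surj ⟨y, hy'⟩
      exact ⟨x, congrArg Subtype.val hx⟩
    · rintro ⟨x, rfl⟩
      have : (M.seq (n + 1)).f _ = 0 := ((M.seq (n + 1 + 1)).f x).2
      change ((M.seq (n + 1)).f _).1 = 0
      exact congrArg Subtype.val this
end

open scoped TensorProduct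

theorem AssZ_map {A B : Type} [CommRing A] [CommRing B] (φ : A →+* B) {E E' : Type}
    [AddCommGroup E] [Module B E] [AddCommGroup E'] [Module B E'] (Φ : E →ₗ[B] E')
    (hΦ : Function.Injective Φ) (Z W : Submodule B E) :
    AssZ φ Z W = AssZ φ (Z.map Φ) (W.map Φ) := by
  have key : ∀ z (b : B), b • z ∈ W ↔ b • Φ z ∈ W.map Φ := by
    intro z b
    rw [← map_smul]
    constructor
    · intro h
      exact ⟨_, h, rfl⟩
    · rintro ⟨w, hw, hw'⟩
      rwa [← hΦ hw']
  ext p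
  constructor
  · rintro ⟨hp, z, hz, hh⟩
    exact ⟨hp, Φ z, ⟨z, hz, rfl⟩, fun a => (hh a).trans (key _ _)⟩
  · rintro ⟨hp, _, ⟨z, hz, rfl⟩, hh⟩
    exact ⟨hp, z, hz, fun a => (hh a).trans (key _ _).symm⟩

section
variable {B : Type} [CommRing B] {P : Type} [AddCommGroup P] [Module B P]
  {l : ℕ} {g : Fin l → B} (S : DGS B P g)

/-- restricted differential -/
def DGS.dr (n : ℕ) : LinearMap.range (S.pr ((n + 1 : ℕ) : ℤ)) →ₗ[B] LinearMap.range (S.pr (n : ℤ)) :=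
  (S.d.domRestrict _).codRestrict _ (by
    rintro ⟨_, y, rfl⟩
    refine ⟨S.d y, ?_⟩
    rw [S.pr_d]
    push_cast
    rfl)

theorem DGS.dr_val (n : ℕ) (x) : (S.dr n x).1 = S.d x.1 := rfl

/-- the resolution attached to an augmented DGS -/
noncomputable def DGS.res [Module.Projective B P] {M : Type} [AddCommGroup M] [Module B M]
    (ε : P →+ M) (h : IsAug S (RingHom.id B) ε)
    (hneg : ∀ x, S.pr (-1) x = 0) :
    Res B M (fun n : ℕ => LinearMap.range (S.pr (n : ℤ))) where
  d := S.dr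
  ε := ({ ε with map_smul' := h.smul } : P →ₗ[B] M).domRestrict _
  proj n := S.proj_range n
  surj := by
    intro m
    obtain ⟨y, rfl⟩ := h.surj m
    exact ⟨⟨S.pr 0 y, y, rfl⟩, h.aug_pr y⟩
  exact0 := by
    rintro ⟨_, y, rfl⟩
    constructor
    · intro hy
      have h0 : S.d (S.pr 0 y) = 0 := by
        have := S.pr_d (-1) y
        rw [hneg] at this
        simpa using this.symm
      obtain ⟨z, hz⟩ := h.exact (S.pr 0 y) h0 hy
      refine ⟨⟨S.pr 1 z, z, by simp⟩, Subtype.ext ?_⟩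
      change S.d (S.pr 1 z) = S.pr 0 y
      have := S.pr_d 0 z
      rw [zero_add] at this
      rw [← this, hz, S.pr_same]
    · rintro ⟨x, hx⟩
      rw [← hx]
      exact h.aug_d x.1
  exact := by
    rintro n ⟨_, y, rfl⟩
    constructor
    · intro hy
      have hε : ε (S.pr ((n + 1 : ℕ) : ℤ) y) = 0 := by
        rw [← h.aug_pr, S.pr_ne (by push_cast; omega), map_zero]
      obtain ⟨z, hz⟩ := h.exact (S.pr ((n + 1 : ℕ) : ℤ) y) (congrArg Subtype.val hy) hε
      refine ⟨⟨S.pr ((n + 1 + 1 : ℕ) : ℤ) z, z, rfl⟩, Subtype.ext ?_⟩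
      change S.d (S.pr ((n + 1 + 1 : ℕ) : ℤ) z) = _
      have := S.pr_d ((n + 1 : ℕ) : ℤ) z
      rw [hz, S.pr_same] at this
      refine Eq.trans ?_ this.symm
      push_cast
      rfl
    · rintro ⟨x, hx⟩
      rw [← hx]
      exact Subtype.ext (S.dd x.1)
end

section
variable {B : Type} [CommRing B] {P : Type} [AddCommGroup P] [Module B P]
  {g : Fin 0 → B} {J : Type} [Fintype J] (S : DGT B P g J) {D : Type} [AddCommGroup D] [Module B D]

/-- the bigraded pieces -/
def DGT.CC (K : ℕ → Submodule B D) (q : ℕ × ℕ) : Submodule B (P →ₗ[B] D) where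
  carrier := {φ | (∀ x, φ (S.pr (q.1 : ℤ) x) = φ x) ∧ ∀ x, φ x ∈ K q.2}
  add_mem' := by
    rintro a b ⟨h1, h2⟩ ⟨h3, h4⟩
    refine ⟨fun x => ?_, fun x => ?_⟩
    · rw [LinearMap.add_apply, LinearMap.add_apply, h1, h3]
    · exact add_mem (h2 x) (h4 x)
  zero_mem' := ⟨fun x => rfl, fun x => zero_mem _⟩
  smul_mem' := by
    rintro c a ⟨h1, h2⟩
    refine ⟨fun x => ?_, fun x => ?_⟩
    · rw [LinearMap.smul_apply, LinearMap.smul_apply, h1]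
    · exact Submodule.smul_mem _ _ (h2 x)

theorem DGT.mem_CC (K : ℕ → Submodule B D) (q : ℕ × ℕ) (φ : P →ₗ[B] D) :
    φ ∈ S.CC K q ↔ (∀ x, φ (S.pr (q.1 : ℤ) x) = φ x) ∧ ∀ x, φ x ∈ K q.2 := Iff.rfl

/-- comparison map -/
def DGT.Phi {N : Type} [AddCommGroup N] [Module B N] (ι : N →ₗ[B] D) (i : ℕ) :
    (LinearMap.range (S.pr (i : ℤ)) →ₗ[B] N) →ₗ[B] (P →ₗ[B] D) :=
  (LinearMap.lcomp B D (S.pr (i : ℤ)).rangeRestrict) ∘ₗ (LinearMap.llcomp B _ N D ι)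

theorem DGT.Phi_apply {N : Type} [AddCommGroup N] [Module B N] (ι : N →ₗ[B] D) (i : ℕ) (ψ x) :
    S.Phi ι i ψ x = ι (ψ ⟨S.pr (i : ℤ) x, x, rfl⟩) := rfl

theorem DGT.Phi_inj {N : Type} [AddCommGroup N] [Module B N] (ι : N →ₗ[B] D)
    (hι : Function.Injective ι) (i : ℕ) : Function.Injective (S.Phi ι i) := by
  intro ψ ψ' h
  ext ⟨_, x, rfl⟩
  apply hι
  exact LinearMap.congr_fun h x

theorem DGT.Phi_range {N : Type} [AddCommGroup N] [Module B N] (ι : N →ₗ[B] D)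
    (hι : Function.Injective ι) (K : ℕ → Submodule B D) (i n : ℕ)
    (hK : LinearMap.range ι = K n) : LinearMap.range (S.Phi ι i) = S.CC K (i, n) := by
  ext φ
  rw [S.mem_CC]
  constructor
  · rintro ⟨ψ, rfl⟩
    refine ⟨fun x => ?_, fun x => ?_⟩
    · rw [S.Phi_apply, S.Phi_apply]
      congr 2
      exact Subtype.ext (S.pr_same _ _)
    · rw [S.Phi_apply, ← hK]
      exact ⟨_, rfl⟩
  · rintro ⟨h1, h2⟩
    let e := LinearEquiv.ofInjective ι hι
    refine ⟨(e.symm : _ →ₗ[B] N) ∘ₗ (φ.codRestrict (LinearMap.range ι) (fun x => hK ▸ h2 x)) ∘ₗ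
      Submodule.subtype _, ?_⟩
    ext x
    rw [S.Phi_apply]
    change ι (e.symm ⟨φ (S.pr (i : ℤ) x), _⟩) = _
    rw [← h1 x]
    exact congrArg Subtype.val (e.apply_symm_apply ⟨φ (S.pr (i : ℤ) x), _⟩)

theorem DGT.Phi_d {N : Type} [AddCommGroup N] [Module B N] (ι : N →ₗ[B] D) (i : ℕ) (ψ) :
    (S.Phi ι i ψ).comp S.d = S.Phi ι (i + 1) (ψ.comp (S.dr i)) := by
  ext x
  rw [LinearMap.comp_apply, S.Phi_apply, S.Phi_apply, LinearMap.comp_apply]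
  congr 2
  apply Subtype.ext
  rw [DGS.dr_val]
  change S.pr (i : ℤ) (S.d x) = _
  rw [S.pr_d]
  push_cast
  rfl

variable [Module.Projective B P] {M : Type} [AddCommGroup M] [Module B M]
    (ε : P →+ M) (h : IsAug S.toDGS (RingHom.id B) ε)

theorem DGT.AssS_eq (hneg : ∀ x, S.pr (-1) x = 0) {A : Type} [CommRing A] (φ : A →+* B)
    {N : Type} [AddCommGroup N] [Module B N] (ι : N →ₗ[B] D)
    (hι : Function.Injective ι) (K : ℕ → Submodule B D) (i n : ℕ)
    (hK : LinearMap.range ι = K n) :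
    (S.res ε h hneg).AssS φ N i =
      AssZ φ (S.CC K (i, n) ⊓ LinearMap.ker (LinearMap.lcomp B D S.d))
        (BdS (LinearMap.lcomp B D S.d) (S.CC K) (i, n)) := by
  unfold Res.AssS
  rw [AssZ_map φ (S.Phi ι i) (S.Phi_inj ι hι i)]
  congr 1
  · ext z
    rw [← S.Phi_range ι hι K i n hK]
    constructor
    · rintro ⟨ψ, hψ, rfl⟩
      refine ⟨⟨ψ, rfl⟩, ?_⟩
      change (S.Phi ι i ψ).comp S.d = 0
      rw [S.Phi_d]
      have : ψ.comp (S.dr i) = 0 := hψ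
      rw [this, map_zero]
    · rintro ⟨⟨ψ, rfl⟩, hz⟩
      refine ⟨ψ, ?_, rfl⟩
      have hz : (S.Phi ι i ψ).comp S.d = 0 := hz
      rw [S.Phi_d] at hz
      exact S.Phi_inj ι hι (i + 1) (hz.trans (map_zero _).symm)
  · cases i with
    | zero =>
      rw [BdS_zero]
      have : (S.res ε h hneg).inc N 0 = 0 := rfl
      rw [this, LinearMap.range_zero, Submodule.map_bot]
    | succ i =>
      rw [BdS_succ, ← S.Phi_range ι hι K i n hK]
      ext z
      constructor
      · rintro ⟨_, ⟨ψ, rfl⟩, rfl⟩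
        exact ⟨_, ⟨ψ, rfl⟩, S.Phi_d ι i ψ⟩
      · rintro ⟨_, ⟨ψ, rfl⟩, rfl⟩
        exact ⟨_, ⟨ψ, rfl⟩, (S.Phi_d ι i ψ).symm⟩

theorem DGT.main [IsNoetherianRing B] [Module.Finite B D] (hneg : ∀ x, S.pr (-1) x = 0)
    {A : Type} [CommRing A] (φ : A →+* B)
    {ι : Type} [Fintype ι] (x : ι → B) (K : ℕ → Submodule B D)
    (hK1 : ∀ j n, ∀ z ∈ K n, x j • z ∈ K (n + 1))
    (hK2 : ∀ n, ∀ z ∈ K (n + 1), ∃ w : ι → K n, z = ∑ j, x j • (w j).1)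
    (N : ℕ → Type) [∀ n, AddCommGroup (N n)] [∀ n, Module B (N n)]
    (u : ∀ n, N n →ₗ[B] D) (hu : ∀ n, Function.Injective (u n))
    (huK : ∀ n, LinearMap.range (u n) = K n) :
    (⋃ q : ℕ × ℕ, (S.res ε h hneg).AssS φ (N q.2) q.1).Finite ∧
    ∃ k, ∀ i ≥ k, ∀ n ≥ k,
      (S.res ε h hneg).AssS φ (N n) (2 * i) = (S.res ε h hneg).AssS φ (N k) (2 * k) ∧
      (S.res ε h hneg).AssS φ (N n) (2 * i + 1) = (S.res ε h hneg).AssS φ (N k) (2 * k + 1) := by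
  classical
  have key := fun (i n : ℕ) => S.AssS_eq ε h hneg φ (u n) (hu n) K i n (huK n)
  simp only [key]
  refine bigraded_main (κ := J) (LinearMap.lcomp B D S.d) (fun j => LinearMap.lcomp B D (S.t j)) x
    (S.CC K) ?_ ?_ ?_ ?_ ?_ ?_ ?_ S.n0.toNat ?_ ?_ A φ
  · intro e
    ext y
    change e (S.d (S.d y)) = 0
    rw [S.dd, map_zero]
  · intro j e
    ext y
    change e (S.d (S.t j y)) = e (S.t j (S.d y))
    rw [S.t_d]
  · intro i j e
    ext y
    change e (S.t j (S.t i y)) = e (S.t i (S.t j y))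
    rw [S.t_t]
  · rintro ⟨i, n⟩ e ⟨h1, h2⟩
    refine ⟨fun y => ?_, fun y => h2 _⟩
    change e (S.d (S.pr ((i + 1 : ℕ) : ℤ) y)) = e (S.d y)
    rw [← h1 (S.d y)]
    change _ = e (S.pr (i : ℤ) (S.d y))
    rw [S.pr_d]
    push_cast
    rfl
  · rintro j ⟨i, n⟩ e ⟨h1, h2⟩
    refine ⟨fun y => ?_, fun y => h2 _⟩
    change e (S.t j (S.pr ((i + 2 : ℕ) : ℤ) y)) = e (S.t j y)
    rw [← h1 (S.t j y)]
    change _ = e (S.pr (i : ℤ) (S.t j y))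
    rw [S.pr_t]
    push_cast
    rfl
  · rintro j ⟨i, n⟩ e ⟨h1, h2⟩
    refine ⟨fun y => ?_, fun y => hK1 j n _ (h2 y)⟩
    change x j • e (S.pr (i : ℤ) y) = x j • e y
    rw [← h1 y]
  · rintro ⟨i, n⟩
    obtain ⟨v, hv⟩ := S.fg (i : ℤ)
    let r : S.CC K (i, n) →ₗ[B] (v → D) :=
      (LinearMap.pi fun a : v => LinearMap.applyₗ (R := B) a.1) ∘ₗ Submodule.subtype _
    have hr : Function.Injective r := by
      rw [injective_iff_map_eq_zero]
      rintro ⟨e, h1, h2⟩ he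
      apply Subtype.ext
      ext y
      change e y = 0
      rw [← h1 y]
      have : Submodule.span B (v : Set P) ≤ LinearMap.ker e := by
        rw [Submodule.span_le]
        intro a ha
        exact congrFun he ⟨a, ha⟩
      exact this (hv ⟨y, rfl⟩)
    haveI : IsNoetherian B (S.CC K (i, n)) := isNoetherian_of_injective r hr
    exact Module.Finite.iff_fg.1 inferInstance
  · rintro ⟨i, n⟩ e ⟨h1, h2⟩ U hU
    let Sm : (ι → K n) →ₗ[B] K (n + 1) :=
      (∑ j, (x j) • ((K n).subtype ∘ₗ LinearMap.proj j)).codRestrict (K (n + 1)) (by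
        intro w
        rw [LinearMap.sum_apply]
        exact Submodule.sum_mem _ fun j _ => hK1 j n _ (w j).2)
    have hSm : ∀ w, (Sm w).1 = ∑ j, x j • (w j).1 := by
      intro w
      change (∑ j, (x j) • ((K n).subtype ∘ₗ LinearMap.proj j)) w = _
      rw [LinearMap.sum_apply]
      rfl
    have hs : Function.Surjective Sm := by
      intro z
      obtain ⟨w, hw⟩ := hK2 n z.1 z.2
      exact ⟨w, Subtype.ext ((hSm w).trans hw.symm)⟩
    obtain ⟨L, hL⟩ := Module.projective_lifting_property Sm (e.codRestrict (K (n + 1)) h2) hs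
    let z : ι → P →ₗ[B] D := fun j =>
      (K n).subtype ∘ₗ LinearMap.proj j ∘ₗ L ∘ₗ S.pr (i : ℤ)
    have hz : ∀ j, z j ∈ S.CC K (i, n) := by
      intro j
      refine ⟨fun y => ?_, fun y => (L (S.pr (i : ℤ) y) j).2⟩
      change (L (S.pr (i : ℤ) (S.pr (i : ℤ) y)) j).1 = (L (S.pr (i : ℤ) y) j).1
      rw [S.pr_same]
    have he : e = ∑ j, x j • z j := by
      ext y
      rw [LinearMap.sum_apply, ← h1 y]
      have := congrArg Subtype.val (LinearMap.congr_fun hL (S.pr (i : ℤ) y))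
      exact this.symm.trans (hSm _)
    rw [he]
    exact Submodule.sum_mem _ fun j _ => hU j _ (hz j)
  · rintro ⟨i, n⟩ hi e ⟨h1, h2⟩ U hU
    have hi : S.n0.toNat ≤ i := hi
    let z : J → P →ₗ[B] D := fun j => e ∘ₗ S.s j ∘ₗ S.pr (i : ℤ)
    have hz : ∀ j, z j ∈ S.CC K (i, n) := by
      intro j
      refine ⟨fun y => ?_, fun y => h2 _⟩
      change e (S.s j (S.pr (i : ℤ) (S.pr (i : ℤ) y))) = e (S.s j (S.pr (i : ℤ) y))
      rw [S.pr_same]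
    have he : e = ∑ j, LinearMap.lcomp B D (S.t j) (z j) := by
      ext y
      rw [LinearMap.sum_apply, ← h1 y]
      change e (S.pr ((i + 2 : ℕ) : ℤ) y) = ∑ j, e (S.s j (S.pr (i : ℤ) (S.t j y)))
      have hlt : S.n0 < ((i + 2 : ℕ) : ℤ) := by
        have := Int.self_le_toNat S.n0
        push_cast
        omega
      rw [← S.s_t _ hlt y, map_sum]
      refine Finset.sum_congr rfl fun j _ => ?_
      rw [S.pr_t]
      push_cast
      rfl
    rw [he]
    exact Submodule.sum_mem _ fun j _ => hU j _ (hz j)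
end

open scoped TensorProduct

section
variable {A B : Type} [CommRing A] [CommRing B] [Algebra A B]
  {D : Type} [AddCommGroup D] [Module A D] (I : Ideal A)

/-- extension of the submodules -/
noncomputable def uu (B : Type) [CommRing B] [Algebra A B] (D : Type) [AddCommGroup D] [Module A D]
    (n : ℕ) : B ⊗[A] ↥(I ^ n • (⊤ : Submodule A D)) →ₗ[B] B ⊗[A] D :=
  (I ^ n • (⊤ : Submodule A D)).subtype.baseChange B

theorem uu_tmul (n : ℕ) (b : B) (t : ↥(I ^ n • (⊤ : Submodule A D))) :
    uu I B D n (b ⊗ₜ t) = b ⊗ₜ t.1 := rfl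

theorem uu_mul (n : ℕ) (a : A) (ha : a ∈ I) (z : B ⊗[A] D) (hz : z ∈ LinearMap.range (uu I B D n)) :
    algebraMap A B a • z ∈ LinearMap.range (uu I B D (n + 1)) := by
  obtain ⟨w, rfl⟩ := hz
  induction w with
  | zero => simp
  | add x y hx hy => rw [map_add, smul_add]; exact add_mem hx hy
  | tmul b t =>
    have h : a • t.1 ∈ I ^ (n + 1) • (⊤ : Submodule A D) := by
      rw [pow_succ', Submodule.mul_smul]
      exact Submodule.smul_mem_smul ha t.2
    refine ⟨b ⊗ₜ ⟨a • t.1, h⟩, ?_⟩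
    rw [uu_tmul, uu_tmul, algebraMap_smul, TensorProduct.tmul_smul]

theorem uu_exists (s : Finset A) (hs : Ideal.span (s : Set A) = I) (n : ℕ) (z : B ⊗[A] D)
    (hz : z ∈ LinearMap.range (uu I B D (n + 1))) :
    ∃ w : s → LinearMap.range (uu I B D n), z = ∑ j, algebraMap A B j.1 • (w j).1 := by
  classical
  let Sm : (s → LinearMap.range (uu I B D n)) →ₗ[B] B ⊗[A] D :=
    ∑ j, (algebraMap A B j.1) • (Submodule.subtype _ ∘ₗ LinearMap.proj j)
  have hSm : ∀ w, Sm w = ∑ j, algebraMap A B j.1 • (w j).1 := by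
    intro w
    change (∑ j : s, (algebraMap A B j.1) • (Submodule.subtype _ ∘ₗ LinearMap.proj j)) w = _
    rw [LinearMap.sum_apply]
    rfl
  suffices h : z ∈ LinearMap.range Sm by
    obtain ⟨w, hw⟩ := h
    exact ⟨w, hw.symm.trans (hSm w)⟩
  let W := LinearMap.range Sm
  have key : I ^ (n + 1) • (⊤ : Submodule A D) ≤
      (W.restrictScalars A).comap (TensorProduct.mk A B D 1) := by
    rw [pow_succ', Submodule.mul_smul, Submodule.smul_le]
    intro r hr t ht
    have : I ≤ ((W.restrictScalars A).comap (TensorProduct.mk A B D 1)).comap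
        (LinearMap.toSpanSingleton A D t) := by
      rw [← hs, Ideal.span, Submodule.span_le]
      intro a ha
      change (1 : B) ⊗ₜ[A] (a • t) ∈ W
      refine ⟨Pi.single ⟨a, ha⟩ ⟨1 ⊗ₜ t, 1 ⊗ₜ ⟨t, ht⟩, rfl⟩, ?_⟩
      rw [hSm, Finset.sum_eq_single ⟨a, ha⟩]
      · rw [Pi.single_eq_same, algebraMap_smul, TensorProduct.tmul_smul]
      · intro b _ hb
        rw [Pi.single_eq_of_ne hb]
        simp
      · simp
    exact this hr
  obtain ⟨w, rfl⟩ := hz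
  induction w with
  | zero => simp
  | add x y hx hy => rw [map_add]; exact add_mem hx hy
  | tmul b t =>
    have h1 : (1 : B) ⊗ₜ[A] t.1 ∈ W := key t.2
    have h2 := W.smul_mem b h1
    rwa [TensorProduct.smul_tmul', smul_eq_mul, mul_one] at h2
end

theorem main_abs (A : Type) [CommRing A] [IsNoetherianRing A]
    (B : Type) [CommRing B] [Algebra A B] [Module.Flat A B]
    (hinj : ∀ (E : Type) [AddCommGroup E] [Module A E],
      Function.Injective (TensorProduct.mk A B E 1))
    (Q : Type) [CommRing Q] [IsLocalRing Q] [IsNoetherianRing Q]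
    (hQreg : ∃ s : Finset Q, Ideal.span (s : Set Q) = IsLocalRing.maximalIdeal Q ∧
      (s.card : WithBot ℕ∞) = ringKrullDim Q)
    (π : Q →+* B)
    (hπ : Function.Surjective π)
    (c : ℕ) (f : Fin c → Q)
    (hreg : RingTheory.Sequence.IsRegular Q (List.ofFn f))
    (hker : RingHom.ker π = Ideal.span (Set.range f))
    (M : Type) [AddCommGroup M] [Module A M] [Module.Finite A M]
    (I : Ideal A) (D : Type) [AddCommGroup D] [Module A D] [Module.Finite A D] :
    (⋃ n : ℕ, ⋃ i : ℕ,
      associatedPrimes A (extAP A M (↥(I ^ n • (⊤ : Submodule A D))) i)).Finite ∧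
    ∃ i₀ n₀ : ℕ, ∀ i ≥ i₀, ∀ n ≥ n₀,
      associatedPrimes A (extAP A M (↥(I ^ n • (⊤ : Submodule A D))) (2 * i)) =
        associatedPrimes A (extAP A M (↥(I ^ n₀ • (⊤ : Submodule A D))) (2 * i₀)) ∧
      associatedPrimes A (extAP A M (↥(I ^ n • (⊤ : Submodule A D))) (2 * i + 1)) =
        associatedPrimes A (extAP A M (↥(I ^ n₀ • (⊤ : Submodule A D))) (2 * i₀ + 1)) := by
  haveI : IsNoetherianRing B := isNoetherianRing_of_surjective Q B π hπ
  obtain ⟨s, hs, hcard⟩ := hQreg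
  have hpd := (regular_aux s.card Q s hs le_rfl hcard.le).2
  obtain ⟨P, _, _, _, J, _, S, ε, hε⟩ := DGT.exists_main π hπ c f hreg.toIsWeaklyRegular hker s.card
    (fun M _ _ _ P _ _ _ _ φ _ => hpd (LinearMap.ker φ)) (B ⊗[A] M) (Fin.elim0)
  obtain ⟨k, ⟨G⟩⟩ := exists_res (⟨M⟩ : FGM A)
  have hneg : ∀ x, S.pr (-1) x = 0 := S.pr_neg (-1) (by norm_num)
  obtain ⟨s', hs'⟩ := (IsNoetherian.noetherian I : I.FG)
  have H := S.main (D := B ⊗[A] D) ε hε hneg (algebraMap A B) (fun j : s' => algebraMap A B j.1)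
    (fun n => LinearMap.range (uu I B D n))
    (fun j n z hz => uu_mul I n j.1 (hs' ▸ Submodule.subset_span j.2) z hz)
    (fun n z hz => uu_exists I s' hs' n z hz)
    (fun n => B ⊗[A] ↥(I ^ n • (⊤ : Submodule A D))) (uu I B D)
    (fun n => Module.Flat.lTensor_preserves_injective_linearMap (M := B)
      (I ^ n • (⊤ : Submodule A D)).subtype Subtype.val_injective) (fun n => rfl)
  have key : ∀ n i, associatedPrimes A (extAP A M (↥(I ^ n • (⊤ : Submodule A D))) i) =
      (S.res ε hε hneg).AssS (algebraMap A B) (B ⊗[A] ↥(I ^ n • (⊤ : Submodule A D))) i :=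
    fun n i => ass_ext G (fun n => inferInstance) _ hinj _ i
  simp only [key]
  refine ⟨?_, ?_⟩
  · refine H.1.subset ?_
    refine Set.iUnion_subset fun n => Set.iUnion_subset fun i => ?_
    exact Set.subset_iUnion (fun q : ℕ × ℕ => (S.res ε hε hneg).AssS (algebraMap A B)
      (B ⊗[A] ↥(I ^ q.2 • (⊤ : Submodule A D))) q.1) (i, n)
  · obtain ⟨k, hk⟩ := H.2
    exact ⟨k, k, hk⟩

/-- Let `(A, 𝔪)` be a local complete intersection: the completion `Â` is
`Q/(f_1,…,f_c)` for a regular local ring `(Q, 𝔫)` (Noetherian local with maximal ideal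
generated by `dim Q` elements) and a `Q`-regular sequence `f_1,…,f_c ∈ 𝔫²`.  Let `M, D` be
finitely generated `A`-modules and `I` an ideal of `A`.  Then (1) the union
`⋃_{n,i} Ass_A Ext^i_A(M, IⁿD)` is finite, and (2) there are `i₀, n₀` with
`Ass_A Ext^{2i}_A(M, IⁿD) = Ass_A Ext^{2i₀}_A(M, I^{n₀}D)` and
`Ass_A Ext^{2i+1}_A(M, IⁿD) = Ass_A Ext^{2i₀+1}_A(M, I^{n₀}D)` for `i ≥ i₀`, `n ≥ n₀`. -/
theorem stmt11 (A : Type) [CommRing A] [IsLocalRing A] [IsNoetherianRing A]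
    (Q : Type) [CommRing Q] [IsLocalRing Q] [IsNoetherianRing Q]
    -- `Q` is regular local: its maximal ideal is generated by `dim Q` elements
    (hQreg : ∃ s : Finset Q, Ideal.span (s : Set Q) = IsLocalRing.maximalIdeal Q ∧
      (s.card : WithBot ℕ∞) = ringKrullDim Q)
    (π : Q →+* AdicCompletion (IsLocalRing.maximalIdeal A) A)
    (hπ : Function.Surjective π)
    (c : ℕ) (f : Fin c → Q)
    (hreg : RingTheory.Sequence.IsRegular Q (List.ofFn f))
    (hf2 : ∀ j : Fin c, f j ∈ (IsLocalRing.maximalIdeal Q) ^ 2)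
    (hker : RingHom.ker π = Ideal.span (Set.range f))
    (M : Type) [AddCommGroup M] [Module A M] [Module.Finite A M]
    (I : Ideal A) (D : Type) [AddCommGroup D] [Module A D] [Module.Finite A D] :
    (⋃ n : ℕ, ⋃ i : ℕ,
      associatedPrimes A (extAP A M (↥(I ^ n • (⊤ : Submodule A D))) i)).Finite ∧
    ∃ i₀ n₀ : ℕ, ∀ i ≥ i₀, ∀ n ≥ n₀,
      associatedPrimes A (extAP A M (↥(I ^ n • (⊤ : Submodule A D))) (2 * i)) =
        associatedPrimes A (extAP A M (↥(I ^ n₀ • (⊤ : Submodule A D))) (2 * i₀)) ∧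
      associatedPrimes A (extAP A M (↥(I ^ n • (⊤ : Submodule A D))) (2 * i + 1)) =
        associatedPrimes A (extAP A M (↥(I ^ n₀ • (⊤ : Submodule A D))) (2 * i₀ + 1)) := by
  haveI hfl : Module.Flat A (AdicCompletion (IsLocalRing.maximalIdeal A) A) :=
    AdicCompletion.flat_of_isNoetherian _
  haveI : Module.FaithfullyFlat A (AdicCompletion (IsLocalRing.maximalIdeal A) A) :=
    Module.FaithfullyFlat.of_flat_of_isLocalHom
  exact main_abs A (AdicCompletion (IsLocalRing.maximalIdeal A) A)
    (fun E _ _ => Module.FaithfullyFlat.tensorProduct_mk_injective E)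
    Q hQreg π hπ c f hreg hker M I D
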